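/- arXiv:2508.12789 — 3 statements merged into one kernel-verified Lean document; each statement's English description precedes it below -/
import Mathlib

section
/- Let n ≥ 5 and let B be a saturated blocker of the convex n-gon. Then there are at least two vertices i such that the ear-cover {i−1,i+1} does not belong to B. -/
open Finset

namespace ConvexBlocker

/-- `c` lies strictly inside the (positively oriented) open arc from `a` to `b`. -/
def Btw (n : ℕ) (a c b : ZMod n) : Prop :=
  0 < (c - a).val ∧ (c - a).val < (b - a).val

/-- Two edges of the convex `n`-gon cross: their endpoints are four pairwise distinct
vertices which interleave in the cyclic order. -/
def Cross (n : ℕ) (e f : Sym2 (ZMod n)) : Prop :=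
  ∃ a b c d : ZMod n, e = s(a, b) ∧ f = s(c, d) ∧
    0 < (c - a).val ∧ (c - a).val < (b - a).val ∧ (b - a).val < (d - a).val

/-- `e` is an edge (an unordered pair of distinct vertices) of the `n`-gon. -/
def IsEdge (n : ℕ) (e : Sym2 (ZMod n)) : Prop :=
  ∃ a b : ZMod n, e = s(a, b) ∧ a ≠ b

/-- `e` is a diagonal of the convex `n`-gon: an edge of order at least 2, i.e. both open
arcs between its endpoints are nonempty. -/
def IsDiagonal (n : ℕ) (e : Sym2 (ZMod n)) : Prop :=
  ∃ a b : ZMod n, e = s(a, b) ∧ a ≠ b ∧ (∃ c, Btw n a c b) ∧ (∃ d, Btw n b d a)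

/-- A triangulation of the convex `n`-gon: an inclusion-maximal set of pairwise
non-crossing diagonals. -/
def IsTriangulation (n : ℕ) (T : Finset (Sym2 (ZMod n))) : Prop :=
  (∀ e ∈ T, IsDiagonal n e) ∧
  (∀ e ∈ T, ∀ f ∈ T, ¬ Cross n e f) ∧
  (∀ e, IsDiagonal n e → e ∉ T → ∃ f ∈ T, Cross n e f)

/-- A blocker of the convex `n`-gon: a set of edges meeting every triangulation. -/
def IsBlocker (n : ℕ) (B : Finset (Sym2 (ZMod n))) : Prop :=
  (∀ e ∈ B, IsEdge n e) ∧
  ∀ T : Finset (Sym2 (ZMod n)), IsTriangulation n T → (B ∩ T).Nonempty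

/-- A saturated blocker of the convex `n`-gon. -/
def IsSaturatedBlocker (n : ℕ) (B : Finset (Sym2 (ZMod n))) : Prop :=
  IsBlocker n B ∧ ∀ e ∈ B, ¬ IsBlocker n (B.erase e)

/-- `e` is an edge of the sub-polygon on the vertex set `S`. -/
def IsEdgeOn (n : ℕ) (S : Finset (ZMod n)) (e : Sym2 (ZMod n)) : Prop :=
  ∃ a b : ZMod n, e = s(a, b) ∧ a ∈ S ∧ b ∈ S ∧ a ≠ b

/-- `e` is a diagonal of the sub-polygon on `S` (with the inherited cyclic order):
its endpoints are distinct members of `S` which are not cyclically consecutive in `S`. -/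
def IsDiagonalOn (n : ℕ) (S : Finset (ZMod n)) (e : Sym2 (ZMod n)) : Prop :=
  ∃ a b : ZMod n, e = s(a, b) ∧ a ∈ S ∧ b ∈ S ∧ a ≠ b ∧
    (∃ c ∈ S, Btw n a c b) ∧ (∃ d ∈ S, Btw n b d a)

/-- A triangulation of the sub-polygon on `S`. -/
def IsTriangulationOn (n : ℕ) (S : Finset (ZMod n)) (T : Finset (Sym2 (ZMod n))) : Prop :=
  (∀ e ∈ T, IsDiagonalOn n S e) ∧
  (∀ e ∈ T, ∀ f ∈ T, ¬ Cross n e f) ∧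
  (∀ e, IsDiagonalOn n S e → e ∉ T → ∃ f ∈ T, Cross n e f)

/-- A blocker of the sub-polygon on `S`. -/
def IsBlockerOn (n : ℕ) (S : Finset (ZMod n)) (B : Finset (Sym2 (ZMod n))) : Prop :=
  (∀ e ∈ B, IsEdgeOn n S e) ∧
  ∀ T : Finset (Sym2 (ZMod n)), IsTriangulationOn n S T → (B ∩ T).Nonempty

/-- A saturated blocker of the sub-polygon on `S`. -/
def IsSaturatedBlockerOn (n : ℕ) (S : Finset (ZMod n)) (B : Finset (Sym2 (ZMod n))) : Prop :=
  IsBlockerOn n S B ∧ ∀ e ∈ B, ¬ IsBlockerOn n S (B.erase e)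

/-- The degree of the vertex `v` in the set of edges `B`. -/
noncomputable def degB (n : ℕ) (B : Finset (Sym2 (ZMod n))) (v : ZMod n) : ℕ :=
  (B.filter (fun e => v ∈ e)).card

end ConvexBlocker

namespace ConvexBlocker

lemma val_sub_cases {n : ℕ} [NeZero n] (a b : ZMod n) :
    (b.val ≤ a.val ∧ (a - b).val = a.val - b.val) ∨
      (a.val < b.val ∧ (a - b).val = n + a.val - b.val) := by
  have ha := a.val_lt
  have hb := b.val_lt
  rcases le_or_gt b.val a.val with h | h
  · exact Or.inl ⟨h, ZMod.val_sub h⟩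
  · refine Or.inr ⟨h, ?_⟩
    have hba : (b - a).val = b.val - a.val := ZMod.val_sub h.le
    have hne : b - a ≠ 0 := by
      intro h0
      rw [h0, ZMod.val_zero] at hba
      omega
    have := ZMod.val_neg_of_ne_zero (b - a) (na := ⟨hne⟩)
    rw [neg_sub] at this
    omega

/-- The distance of `a` from `b + 1`, in terms of its distance from `b`. -/
lemma val_sub_add_one {n : ℕ} [NeZero n] (hn : 2 ≤ n) (a b : ZMod n) :
    ((a - b).val = 0 ∧ (a - (b + 1)).val = n - 1) ∨
      (0 < (a - b).val ∧ (a - (b + 1)).val = (a - b).val - 1) := by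
  have : Fact (1 < n) := ⟨hn⟩
  have h := val_sub_cases (a - b) 1
  rw [ZMod.val_one n, sub_sub] at h
  omega

lemma val_add_one_sub {n : ℕ} [NeZero n] (hn : 2 ≤ n) (a b : ZMod n) :
    ((a - b).val = n - 1 ∧ (a + 1 - b).val = 0) ∨
      ((a - b).val < n - 1 ∧ (a + 1 - b).val = (a - b).val + 1) := by
  have h := val_sub_add_one hn (a + 1) b
  rw [add_sub_add_right_eq_sub] at h
  have := (a - b).val_lt
  have := (a + 1 - b).val_lt
  omega

lemma eq_of_val_sub_eq {n : ℕ} [NeZero n] {a b x : ZMod n} (h : (a - x).val = (b - x).val) :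
    a = b :=
  sub_left_injective (ZMod.val_injective n h)

lemma val_add_one_sub_self {n : ℕ} [NeZero n] (hn : 5 ≤ n) (x : ZMod n) :
    (x + 1 - x).val = 1 := by
  have : Fact (1 < n) := ⟨by omega⟩
  rw [add_sub_cancel_left, ZMod.val_one n]

lemma val_add_two_sub_self {n : ℕ} [NeZero n] (hn : 5 ≤ n) (x : ZMod n) :
    (x + 1 + 1 - x).val = 2 := by
  have h1 := val_add_one_sub_self hn x
  have h2 := val_add_one_sub (by omega) (x + 1) x
  omega

lemma isDiagonal_ear_cover {n : ℕ} [NeZero n] (hn : 5 ≤ n) (x : ZMod n) :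
    IsDiagonal n s(x, x + 1 + 1) := by
  have h1 := val_add_one_sub_self hn x
  have h2 := val_add_two_sub_self hn x
  have h3 := val_add_one_sub_self hn (x + 1 + 1)
  have h4 := val_sub_add_one (by omega) x x
  have h5 := val_sub_add_one (by omega) x (x + 1)
  have h6 : (x - x).val = 0 := by rw [sub_self, ZMod.val_zero]
  refine ⟨x, x + 1 + 1, rfl, ?_, ⟨x + 1, ?_⟩, ⟨x + 1 + 1 + 1, ?_⟩⟩
  · intro h
    rw [← h] at h2
    omega
  · unfold Btw
    omega
  · unfold Btw
    omega

/-- An edge crossing the ear-cover of `x + 1` joins `x + 1` to a vertex beyond `x + 2`. -/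
lemma Cross.exists_of_ear_cover {n : ℕ} [NeZero n] (hn : 5 ≤ n) {x : ZMod n}
    {f : Sym2 (ZMod n)} (hf : Cross n s(x, x + 1 + 1) f) :
    ∃ z, f = s(x + 1, z) ∧ 2 < (z - x).val := by
  obtain ⟨a, b, c, d, hab, rfl, h1, h2, h3⟩ := hf
  have hx1 := val_add_one_sub_self hn x
  have hx2 := val_add_two_sub_self hn x
  rcases Sym2.eq_iff.mp hab with ⟨rfl, rfl⟩ | ⟨rfl, rfl⟩
  · obtain rfl : c = x + 1 := eq_of_val_sub_eq (x := x) (by omega)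
    exact ⟨d, rfl, by omega⟩
  · have h6 : (x - x).val = 0 := by rw [sub_self, ZMod.val_zero]
    have h4 := val_sub_add_one (by omega) x x
    have h5 := val_sub_add_one (by omega) x (x + 1)
    have hd := (d - (x + 1)).val_lt
    have hd2 := val_sub_add_one (by omega) d x
    have hd3 := val_sub_add_one (by omega) d (x + 1)
    have hc2 := val_sub_add_one (by omega) c x
    have hc3 := val_sub_add_one (by omega) c (x + 1)
    obtain rfl : d = x + 1 := eq_of_val_sub_eq (x := x) (by omega)
    exact ⟨c, Sym2.eq_swap, by omega⟩

/-- On each side of an edge of a triangulation of the `n`-gon there is an ear. -/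
lemma IsTriangulation.exists_ear_cover {n : ℕ} [NeZero n] (hn : 5 ≤ n)
    {T : Finset (Sym2 (ZMod n))} (hT : IsTriangulation n T) {x y : ZMod n}
    (hxy : s(x, y) ∈ T) (hlen : 2 ≤ (y - x).val) :
    ∃ i, Btw n x i y ∧ s(i - 1, i + 1) ∈ T := by
  induction hL : (y - x).val using Nat.strong_induction_on generalizing x y with
  | _ L ih =>
  have hx1 := val_add_one_sub_self hn x
  by_cases hear : s(x, x + 1 + 1) ∈ T
  · exact ⟨x + 1, ⟨by omega, by omega⟩, by rwa [add_sub_cancel_right]⟩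
  have hx2 := val_add_two_sub_self hn x
  have hL2 : (y - x).val ≠ 2 := by
    intro h
    rw [eq_of_val_sub_eq (h.trans hx2.symm)] at hxy
    exact hear hxy
  obtain ⟨f, hfT, hf⟩ := hT.2.2 _ (isDiagonal_ear_cover hn x) hear
  obtain ⟨z, rfl, hz⟩ := hf.exists_of_ear_cover hn
  have hzy : (z - x).val ≤ (y - x).val := by
    by_contra! h
    exact hT.2.1 _ hxy _ hfT ⟨x, y, x + 1, z, rfl, rfl, by omega, by omega, h⟩
  have hz1 := val_sub_add_one (by omega) z x
  obtain ⟨i, ⟨hi1, hi2⟩, hiT⟩ := ih _ (by omega) hfT (by omega) rfl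
  have hi := val_sub_add_one (by omega) i x
  have hlt := (z - x).val_lt
  exact ⟨i, ⟨by omega, by omega⟩, hiT⟩

/-- Each edge of a saturated blocker has a triangulation meeting the
blocker in that edge only. -/
lemma IsSaturatedBlocker.exists_triangulation {n : ℕ} {B : Finset (Sym2 (ZMod n))}
    (hB : IsSaturatedBlocker n B) {e : Sym2 (ZMod n)} (he : e ∈ B) :
    ∃ T, IsTriangulation n T ∧ e ∈ T ∧ ∀ f ∈ B, f ∈ T → f = e := by
  have h := hB.2 e he
  unfold IsBlocker at h
  push Not at h
  obtain ⟨T, hT, hempty⟩ := h fun f hf => hB.1.1 f (mem_of_mem_erase hf)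
  have huniq : ∀ f ∈ B, f ∈ T → f = e := by
    intro f hfB hfT
    by_contra hne
    have : f ∈ B.erase e ∩ T := mem_inter.mpr ⟨mem_erase.mpr ⟨hne, hfB⟩, hfT⟩
    simp [hempty] at this
  obtain ⟨f, hf⟩ := hB.1.2 T hT
  obtain ⟨hfB, hfT⟩ := mem_inter.mp hf
  exact ⟨T, hT, huniq f hfB hfT ▸ hfT, huniq⟩

end ConvexBlocker

open ConvexBlocker in
/-- any saturated blocker of the convex `n`-gon (`n ≥ 5`) has at least two
vertices which are not covered by ear-covers of the blocker. -/
theorem two_uncovered_vertices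
    (n : ℕ) (hn : 5 ≤ n) (B : Finset (Sym2 (ZMod n))) (hB : IsSaturatedBlocker n B) :
    ∃ i j : ZMod n, i ≠ j ∧ s(i - 1, i + 1) ∉ B ∧ s(j - 1, j + 1) ∉ B := by
  have : NeZero n := ⟨by omega⟩
  by_contra! hcon
  obtain ⟨v, hv⟩ : ∃ v : ZMod n, ∀ i, i ≠ v → s(i - 1, i + 1) ∈ B := by
    by_cases h : ∃ v : ZMod n, s(v - 1, v + 1) ∉ B
    · obtain ⟨v, hv⟩ := h
      exact ⟨v, fun i hi => hcon v i hi.symm hv⟩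
    · push Not at h
      exact ⟨0, fun i _ => h i⟩
  have hv0 : (v - v).val = 0 := by rw [sub_self, ZMod.val_zero]
  have hv1 := val_add_one_sub_self hn v
  have hne : v + 1 ≠ v := by
    intro h
    rw [h] at hv1
    omega
  have he := hv _ hne
  rw [add_sub_cancel_right] at he
  obtain ⟨T, hT, heT, huniq⟩ := hB.exists_triangulation he
  have h1 := val_sub_add_one (by omega) v v
  have h2 := val_sub_add_one (by omega) v (v + 1)
  rw [Sym2.eq_swap] at heT
  obtain ⟨i, ⟨hi1, hi2⟩, hiT⟩ := hT.exists_ear_cover hn heT (by omega)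
  have hiv : i ≠ v := by
    rintro rfl
    omega
  rcases Sym2.eq_iff.mp (huniq _ (hv i hiv) hiT) with ⟨h, -⟩ | ⟨h, h'⟩
  · obtain rfl : i = v + 1 := by rw [← h, sub_add_cancel]
    have h3 := val_sub_add_one (by omega) (v + 1) (v + 1)
    rw [sub_self, ZMod.val_zero] at h3
    omega
  · obtain rfl : i = v + 1 + 1 + 1 := by rw [← h, sub_add_cancel]
    have h3 := val_add_two_sub_self hn (v + 1 + 1)
    rw [h'] at h3
    omega
end

section
/- Let n ≥ 7 and let B be a saturated blocker of size n−2 of the convex n-gon in standard form with parameters m and i_1,…,i_{n−3−m}. Let i be a vertex with m+2 ≤ i ≤ n−1, insert a new vertex v between i and i+1 (indices mod n, so the pair (n−1, 0) is allowed), and let e₁, e₂ be two distinct edges of the resulting (n+1)-gon incident to v. Then B ∪ {e₁, e₂} is a saturated blocker of size n of the (n+1)-gon if and only if one of the following two situations holds: (1) there are vertices k and ℓ with m+2 < k < i such that {i,ℓ} and {k,ℓ−1} are beams of B, {k,ℓ−1} is the unique beam of B crossing {i,ℓ}, and {e₁,e₂} = {{v,k},{v,ℓ+1}}; (2) there are vertices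 k and ℓ with k > i+1 such that {i+1,ℓ} and {k,ℓ+1} are beams of B, {k,ℓ+1} is the unique beam of B crossing {i+1,ℓ}, and {e₁,e₂} = {{v,k},{v,ℓ−1}}. -/
open Finset

namespace ConvexBlocker

/-- `B` is a saturated blocker of size `n-2` in standard form with parameters `m` and
`idx 1, …, idx (n-3-m)`: `B` consists of the boundary net `{j,j+2}` (`0 ≤ j ≤ m`) together
with the beams `{m+2+j, idx j}` (`1 ≤ j ≤ n-3-m`, `1 ≤ idx j ≤ m+1`), where beams whose lower
endpoints differ by at least 2 do not cross. -/
def StdForm (n m : ℕ) (idx : ℕ → ℕ) (B : Finset (Sym2 (ZMod n))) : Prop :=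
  1 ≤ m ∧ m ≤ n - 3 ∧
  (∀ j ∈ Finset.Icc 1 (n - 3 - m), 1 ≤ idx j ∧ idx j ≤ m + 1) ∧
  B = ((Finset.range (m + 1)).image
        (fun j : ℕ => s((j : ZMod n), ((j + 2 : ℕ) : ZMod n)))) ∪
      ((Finset.Icc 1 (n - 3 - m)).image
        (fun j : ℕ => s(((m + 2 + j : ℕ) : ZMod n), ((idx j : ℕ) : ZMod n)))) ∧
  (∀ j ∈ Finset.Icc 1 (n - 3 - m), ∀ k ∈ Finset.Icc 1 (n - 3 - m),
    (idx j + 2 ≤ idx k ∨ idx k + 2 ≤ idx j) →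
    ¬ Cross n (s(((m + 2 + j : ℕ) : ZMod n), ((idx j : ℕ) : ZMod n)))
              (s(((m + 2 + k : ℕ) : ZMod n), ((idx k : ℕ) : ZMod n))))

/-- `e` is a beam of the standard-form blocker with parameters `m`, `idx`. -/
def IsBeamEdge (n m : ℕ) (idx : ℕ → ℕ) (e : Sym2 (ZMod n)) : Prop :=
  ∃ j ∈ Finset.Icc 1 (n - 3 - m), e = s(((m + 2 + j : ℕ) : ZMod n), ((idx j : ℕ) : ZMod n))

/-- Inserting a new vertex between the vertices `i` and `i+1` of the `n`-gon: the map sending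
each old vertex to its label in the resulting `(n+1)`-gon (the new vertex gets label `i+1`). -/
def insVx (n i : ℕ) (j : ZMod n) : ZMod (n + 1) :=
  if j.val ≤ i then ((j.val : ℕ) : ZMod (n + 1)) else ((j.val + 1 : ℕ) : ZMod (n + 1))

/-- The induced map on edges for the insertion of a new vertex between `i` and `i+1`. -/
def insEdge (n i : ℕ) : Sym2 (ZMod n) → Sym2 (ZMod (n + 1)) :=
  Sym2.map (insVx n i)

end ConvexBlocker


namespace ConvexBlocker

/-- The polygon on the consecutive vertices `p, …, q` has a triangulation all of whose edges,
including `{p, q}` but not the sides, satisfy `A`. -/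
inductive Tri (A : ℕ → ℕ → Prop) : ℕ → ℕ → Prop
  | side (p : ℕ) : Tri A p (p + 1)
  | glue {p c q : ℕ} : A p q → Tri A p c → Tri A c q → Tri A p q

namespace Tri

variable {A : ℕ → ℕ → Prop} {p q : ℕ}

theorem lt (h : Tri A p q) : p < q := by
  induction h with
  | side p => exact Nat.lt_succ_self p
  | glue _ _ _ h₁ h₂ => exact h₁.trans h₂

/-- The triangulation in which all diagonals start at `p`. -/
theorem fan (hpq : p < q) (hA : ∀ x, p + 1 < x → x ≤ q → A p x) : Tri A p q := by
  induction q, hpq using Nat.le_induction with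
  | base => exact side p
  | succ x hx ih =>
    exact glue (hA _ (by omega) le_rfl) (ih fun y h₁ h₂ => hA y h₁ (by omega)) (side x)

/-- The triangulation in which all diagonals end at `q`. -/
theorem cofan (hpq : p < q) (hA : ∀ x, p ≤ x → x + 1 < q → A x q) : Tri A p q := by
  obtain ⟨k, rfl⟩ := Nat.exists_eq_add_of_lt hpq
  induction k generalizing p with
  | zero => exact side p
  | succ k ih =>
    have e : p + (k + 1) + 1 = p + 1 + k + 1 := by omega
    rw [e] at hA ⊢
    exact glue (hA p le_rfl (by omega)) (side p)
      (ih (by omega) fun x h₁ h₂ => hA x (by omega) h₂)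

/-- Monotonicity in the allowed diagonals, within the labels `s, …, t`. -/
theorem mono_window {A' : ℕ → ℕ → Prop} {s t : ℕ}
    (hA : ∀ a b, s ≤ a → a < b → b ≤ t → A a b → A' a b)
    (h : Tri A p q) (hp : s ≤ p) (hq : q ≤ t) : Tri A' p q := by
  induction h with
  | side p => exact side p
  | glue hpq h₁ h₂ ih₁ ih₂ =>
    have := h₁.lt
    have := h₂.lt
    exact glue (hA _ _ hp (by omega) hq hpq) (ih₁ hp (by omega)) (ih₂ (by omega) hq)

end Tri

/-- The diagonals `{a, b}` and `{c, d}`, where `a < b` and `c < d`, cross. -/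
def LinCross (a b c d : ℕ) : Prop := (a < c ∧ c < b ∧ b < d) ∨ (c < a ∧ a < d ∧ d < b)

/-- A triangulation given recursively can be written as a maximal set of noncrossing pairs. -/
theorem Tri.exists_finset {A : ℕ → ℕ → Prop} {p q : ℕ} (h : Tri A p q) :
    ∃ T : Finset (ℕ × ℕ),
      (∀ a b, (a, b) ∈ T → p ≤ a ∧ a + 1 < b ∧ b ≤ q ∧ A a b) ∧
      (∀ a b c d, (a, b) ∈ T → (c, d) ∈ T → ¬ LinCross a b c d) ∧
      (∀ a b, p ≤ a → a + 1 < b → b ≤ q → (a, b) ∉ T → ∃ c d, (c, d) ∈ T ∧ LinCross a b c d) ∧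
      (p + 1 < q → (p, q) ∈ T) := by
  induction h with
  | side p =>
    refine ⟨∅, by simp, by simp, fun a b _ _ _ => by omega, fun h => by omega⟩
  | @glue p c q hA h₁ h₂ ih₁ ih₂ =>
    obtain ⟨T₁, s₁, n₁, m₁, t₁⟩ := ih₁
    obtain ⟨T₂, s₂, n₂, m₂, t₂⟩ := ih₂
    have hpc := h₁.lt
    have hcq := h₂.lt
    refine ⟨insert (p, q) (T₁ ∪ T₂), ?_, ?_, ?_, ?_⟩
    · intro a b hab
      simp only [Finset.mem_insert, Finset.mem_union, Prod.mk.injEq] at hab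
      rcases hab with ⟨rfl, rfl⟩ | hab | hab
      · exact ⟨le_rfl, by omega, le_rfl, hA⟩
      · obtain ⟨h1, h2, h3, h4⟩ := s₁ a b hab
        exact ⟨h1, h2, by omega, h4⟩
      · obtain ⟨h1, h2, h3, h4⟩ := s₂ a b hab
        exact ⟨by omega, h2, h3, h4⟩
    · intro a b c' d hab hcd
      simp only [Finset.mem_insert, Finset.mem_union, Prod.mk.injEq] at hab hcd
      have k₁ : ∀ a b, (a, b) ∈ T₁ → p ≤ a ∧ a + 1 < b ∧ b ≤ c := fun a b h =>
        ⟨(s₁ a b h).1, (s₁ a b h).2.1, (s₁ a b h).2.2.1⟩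
      have k₂ : ∀ a b, (a, b) ∈ T₂ → c ≤ a ∧ a + 1 < b ∧ b ≤ q := fun a b h =>
        ⟨(s₂ a b h).1, (s₂ a b h).2.1, (s₂ a b h).2.2.1⟩
      rcases hab with hab | hab | hab <;> rcases hcd with hcd | hcd | hcd
      case inr.inl.inr.inl => exact n₁ _ _ _ _ hab hcd
      case inr.inr.inr.inr => exact n₂ _ _ _ _ hab hcd
      all_goals
        first | have g₁ := k₁ _ _ hab | have g₁ := k₂ _ _ hab | have g₁ := hab
        first | have g₂ := k₁ _ _ hcd | have g₂ := k₂ _ _ hcd | have g₂ := hcd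
        unfold LinCross
        omega
    · intro a b ha hab hb hn
      simp only [Finset.mem_insert, Finset.mem_union, Prod.mk.injEq, not_or] at hn ⊢
      obtain ⟨hn, hn₁, hn₂⟩ := hn
      by_cases hbc : b ≤ c
      · obtain ⟨x, y, hxy, hc⟩ := m₁ a b ha hab hbc hn₁
        exact ⟨x, y, Or.inr (Or.inl hxy), hc⟩
      by_cases hac : c ≤ a
      · obtain ⟨x, y, hxy, hc⟩ := m₂ a b hac hab hb hn₂
        exact ⟨x, y, Or.inr (Or.inr hxy), hc⟩
      by_cases hap : a = p
      · exact ⟨c, q, Or.inr (Or.inr (t₂ (by omega))), by unfold LinCross; omega⟩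
      · exact ⟨p, c, Or.inr (Or.inl (t₁ (by omega))), by unfold LinCross; omega⟩
    · exact fun _ => Finset.mem_insert_self _ _

/-- The numerical data of a standard-form blocker around the place `i` of insertion: the outer
vertex `j` has a beam to `F j`, and the two ends `n` (that is, `0`) and `m + 2` of the boundary net
count as having the beams `{0, 2}` and `{m, m + 2}`. -/
structure BeamData (n m i : ℕ) (F : ℕ → ℕ) : Prop where
  one_le_m : 1 ≤ m
  le_i : m + 2 ≤ i
  i_lt : i < n
  right_end : F n = 2
  left_end : F (m + 2) = m
  pos : ∀ j, m + 2 ≤ j → j ≤ n → 1 ≤ F j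
  le : ∀ j, m + 2 ≤ j → j ≤ n → F j ≤ m + 1
  jump : ∀ t u, m + 2 ≤ t → t < u → u ≤ n → F u ≤ F t + 1

/-- The edges of the blocker in the unrolled labelling: for `i < p < q ≤ n + i`, the labels
`p, q` modulo `n` span an edge of the blocker. -/
def Bad (n m i : ℕ) (F : ℕ → ℕ) (p q : ℕ) : Prop :=
  (n ≤ p ∧ q = p + 2 ∧ q ≤ n + m + 2) ∨ (i < p ∧ p < n ∧ q = n + F p) ∨
    (n + m + 2 < q ∧ q ≤ n + i ∧ p = n + F (q - n))

/-- The combinatorial criterion for the existence of a triangulation avoiding the blocker and those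
edges at the inserted vertex whose other end violates `P`. -/
def Crit (n m i : ℕ) (F : ℕ → ℕ) (P : ℕ → Prop) : Prop :=
  ∃ u q t q', i < u ∧ u ≤ n ∧ m + 2 ≤ t ∧ t ≤ i ∧ 1 ≤ q ∧ q < F u ∧ F t < q' ∧ q' ≤ m + 1 ∧
    P u ∧ P (n + t) ∧ ∀ w, q ≤ w → w ≤ q' → P (n + w)

section

variable {n m i : ℕ} {F : ℕ → ℕ} {A : ℕ → ℕ → Prop}

theorem Tri.net (hA : ∀ p q, i < p → p < q → q ≤ n + i → A p q → ¬ Bad n m i F p q)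
    (hF : BeamData n m i F) {p q : ℕ} (h : Tri A p q) (hp : n ≤ p) (hq : q ≤ n + m + 2) :
    q = p + 1 := by
  have := hF.i_lt
  have := hF.le_i
  induction h with
  | side p => rfl
  | @glue p c q hpq h₁ h₂ ih₁ ih₂ =>
    have := h₁.lt
    have := h₂.lt
    have e₁ := ih₁ hp (by omega)
    have e₂ := ih₂ (by omega) hq
    exact absurd (Or.inl ⟨hp, by omega, hq⟩) (hA p q (by omega) (by omega) (by omega) hpq)

theorem Tri.right (hA : ∀ p q, i < p → p < q → q ≤ n + i → A p q → ¬ Bad n m i F p q)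
    (hF : BeamData n m i F) {p q : ℕ} (h : Tri A p q) (hip : i < p) (hp : p ≤ n) (hq : n + 1 ≤ q)
    (hq' : q ≤ n + m + 1) : q < n + F p := by
  have := hF.i_lt
  have := hF.le_i
  have hn := hF.right_end
  induction h with
  | side p =>
    obtain rfl : p = n := by omega
    omega
  | @glue p c q hpq h₁ h₂ ih₁ ih₂ =>
    have := h₁.lt
    have := h₂.lt
    have hb := hA p q (by omega) (by omega) (by omega) hpq
    have hne : q ≠ n + F p := by
      intro e
      apply hb
      rcases hp.lt_or_eq with hp | rfl
      · exact Or.inr (Or.inl ⟨hip, hp, e⟩)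
      · exact Or.inl ⟨le_rfl, by omega, by omega⟩
    by_cases hc : c ≤ n
    · have := ih₂ (by omega) hc hq hq'
      have := hF.jump p c (by omega) (by omega) hc
      omega
    · have := ih₁ hip hp (by omega) (by omega)
      have := Tri.net hA hF h₂ (by omega) (by omega)
      omega

theorem Tri.left (hA : ∀ p q, i < p → p < q → q ≤ n + i → A p q → ¬ Bad n m i F p q)
    (hF : BeamData n m i F) {p q : ℕ} (h : Tri A p q) (hp : n + 1 ≤ p) (hp' : p ≤ n + m + 1)
    (hq : n + m + 2 ≤ q) (hq' : q ≤ n + i) : n + F (q - n) < p := by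
  have := hF.i_lt
  have := hF.le_i
  have hl := hF.left_end
  induction h with
  | side p =>
    obtain rfl : p = n + m + 1 := by omega
    have : n + m + 1 + 1 - n = m + 2 := by omega
    rw [this]
    omega
  | @glue p c q hpq h₁ h₂ ih₁ ih₂ =>
    have := h₁.lt
    have := h₂.lt
    have hb := hA p q (by omega) (by omega) (by omega) hpq
    have hne : p ≠ n + F (q - n) := by
      intro e
      apply hb
      rcases hq.lt_or_eq with hq | rfl
      · exact Or.inr (Or.inr ⟨hq, hq', e⟩)
      · have : n + m + 2 - n = m + 2 := by omega
        rw [this] at e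
        exact Or.inl ⟨by omega, by omega, by omega⟩
    by_cases hc : n + m + 2 ≤ c
    · have := ih₁ hp hp' hc (by omega)
      have := hF.jump (c - n) (q - n) (by omega) (by omega) (by omega)
      omega
    · have := ih₂ (by omega) (by omega) hq hq'
      have := Tri.net hA hF h₁ (by omega) (by omega)
      omega

theorem Tri.span_false (hA : ∀ p q, i < p → p < q → q ≤ n + i → A p q → ¬ Bad n m i F p q)
    (hF : BeamData n m i F) {p q : ℕ} (h : Tri A p q) (hip : i < p) (hp : p ≤ n)
    (hq : n + m + 2 ≤ q) (hq' : q ≤ n + i) : False := by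
  have := hF.i_lt
  have := hF.le_i
  induction h with
  | side p => omega
  | @glue p c q hpq h₁ h₂ ih₁ ih₂ =>
    have := h₁.lt
    have := h₂.lt
    by_cases hc : c ≤ n
    · exact ih₂ (by omega) hc hq hq'
    by_cases hc' : n + m + 2 ≤ c
    · exact ih₁ hip hp hc' (by omega)
    have := Tri.right hA hF h₁ hip hp (by omega) (by omega)
    have := Tri.left hA hF h₂ (by omega) (by omega) hq hq'
    have := hF.jump (q - n) p (by omega) (by omega) hp
    omega

/-- What a triangulation of the polygon `i, …, x` tells about the neighbours of `i`. -/
theorem Tri.fan_structure (hA : ∀ p q, i < p → p < q → q ≤ n + i → A p q → ¬ Bad n m i F p q)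
    (hF : BeamData n m i F) (hs : A i (i + 1)) {p x : ℕ} (h : Tri A p x) (hpi : p = i)
    (hx : x ≤ n + i) :
    (x ≤ n → A i x) ∧
    (n + 1 ≤ x → x ≤ n + m + 1 → ∃ u q, i < u ∧ u ≤ n ∧ 1 ≤ q ∧ q < F u ∧ A i u ∧ n + q ≤ x ∧
      ∀ w, n + q ≤ w → w ≤ x → A i w) ∧
    (n + m + 2 ≤ x → Crit n m i F (A i)) := by
  have := hF.i_lt
  have := hF.le_i
  induction h with
  | side p =>
    subst hpi
    exact ⟨fun _ => hs, fun _ _ => by omega, fun _ => by omega⟩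
  | @glue p c x hpx h₁ h₂ ih₁ _ =>
    subst hpi
    have := h₁.lt
    have := h₂.lt
    obtain ⟨r₁, r₂, r₃⟩ := ih₁ rfl (by omega)
    refine ⟨fun _ => hpx, fun hx₁ hx₂ => ?_, fun hx₁ => ?_⟩
    · by_cases hc : c ≤ n
      · have := Tri.right hA hF h₂ (by omega) hc hx₁ hx₂
        refine ⟨c, x - n, by omega, hc, by omega, by omega, r₁ hc, by omega, fun w _ _ => ?_⟩
        obtain rfl : w = x := by omega
        exact hpx
      · obtain ⟨u, q, h1, h2, h3, h4, h5, h6, h7⟩ := r₂ (by omega) (by omega)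
        obtain rfl := Tri.net hA hF h₂ (by omega) (by omega)
        refine ⟨u, q, h1, h2, h3, h4, h5, by omega, fun w hw₁ hw₂ => ?_⟩
        rcases hw₂.lt_or_eq with hw | rfl
        · exact h7 w hw₁ (by omega)
        · exact hpx
    · by_cases hc : c ≤ n
      · exact (Tri.span_false hA hF h₂ (by omega) hc hx₁ hx).elim
      by_cases hc' : n + m + 2 ≤ c
      · exact r₃ hc'
      have := Tri.left hA hF h₂ (by omega) (by omega) hx₁ hx
      obtain ⟨u, q, h1, h2, h3, h4, h5, h6, h7⟩ := r₂ (by omega) (by omega)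
      refine ⟨u, q, x - n, c - n, h1, h2, by omega, by omega, h3, h4, by omega, by omega, h5, ?_,
        fun w _ _ => h7 _ (by omega) (by omega)⟩
      rwa [Nat.add_sub_cancel' (by omega)]

theorem Tri.of_crit (hA : ∀ p q, i < p → p < q → q ≤ n + i → ¬ Bad n m i F p q → A p q)
    (hF : BeamData n m i F) (hs : A i (n + i)) (h : Crit n m i F (A i)) : Tri A i (n + i) := by
  obtain ⟨u, q, t, q', hu, hu', ht, ht', hq, hq', hFt, hq'm, hAu, hAt, hAw⟩ := h
  have := hF.i_lt
  have := hF.le_i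
  have := hF.right_end
  have := hF.left_end
  have hju := hF.jump t u ht (by omega) hu'
  have := hF.le u (by omega) hu'
  have := hF.pos t ht (by omega)
  have T₁ : Tri A i u := by
    rcases Nat.lt_or_ge (i + 1) u with h | h
    · refine Tri.glue hAu (Tri.side i) (Tri.fan h fun x h₁ h₂ => hA _ _ ?_ ?_ ?_ ?_)
      any_goals omega
      have := hF.pos (i + 1) (by omega) (by omega)
      unfold Bad
      omega
    · obtain rfl : u = i + 1 := by omega
      exact Tri.side i
  have T₂ : Tri A i (n + q) := by
    refine Tri.glue (hAw q le_rfl (by omega)) T₁ (Tri.fan (by omega) fun x h₁ h₂ => hA _ _ ?_ ?_ ?_ ?_)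
    any_goals omega
    rintro (h | h | h)
    · obtain rfl : u = n := by omega
      omega
    · omega
    · omega
  have T₃ : ∀ k, q + k ≤ q' → Tri A i (n + (q + k)) := by
    intro k hk
    induction k with
    | zero => exact T₂
    | succ k ih => exact Tri.glue (hAw _ (by omega) hk) (ih (by omega)) (Tri.side _)
  have T₄ : Tri A i (n + q') := by
    have := T₃ (q' - q) (by omega)
    rwa [Nat.add_sub_cancel' (by omega)] at this
  have T₅ : Tri A i (n + t) := by
    refine Tri.glue hAt T₄ (Tri.cofan (by omega) fun x h₁ h₂ => hA _ _ ?_ ?_ ?_ ?_)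
    any_goals omega
    rintro (h | h | h)
    · obtain rfl : t = m + 2 := by omega
      omega
    · omega
    · rw [Nat.add_sub_cancel_left] at h
      omega
  rcases ht'.lt_or_eq with h | rfl
  · refine Tri.glue hs T₅ (Tri.cofan (by omega) fun x h₁ h₂ => hA _ _ ?_ ?_ ?_ ?_)
    any_goals omega
    have := hF.le i (by omega) (by omega)
    unfold Bad
    rw [Nat.add_sub_cancel_left]
    omega
  · exact T₅

theorem tri_iff_crit (hA : ∀ p q, i < p → p < q → q ≤ n + i → (A p q ↔ ¬ Bad n m i F p q))
    (hF : BeamData n m i F) (hs : A i (i + 1)) (hs' : A i (n + i)) :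
    Tri A i (n + i) ↔ Crit n m i F (A i) := by
  have := hF.le_i
  exact ⟨fun h => (Tri.fan_structure (fun p q h₁ h₂ h₃ => (hA p q h₁ h₂ h₃).1) hF hs h rfl le_rfl).2.2
    (by omega), Tri.of_crit (fun p q h₁ h₂ h₃ => (hA p q h₁ h₂ h₃).2) hF hs'⟩

end

end ConvexBlocker

namespace ConvexBlocker

section

variable {N : ℕ} {s d : ℕ}

theorem val_sub_cast (hN : 0 < N) {a b : ℕ} (ha : s ≤ a) (ha' : a < s + N) (hb : s ≤ b)
    (hb' : b < s + N) :
    (((b + d : ℕ) : ZMod N) - ((a + d : ℕ) : ZMod N)).val = if a ≤ b then b - a else b + N - a := by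
  have key : ∀ k : ℕ, k < N → (b + d : ℕ) + (0 : ℕ) = (a + d) + k ∨ (b + d : ℕ) + N = (a + d) + k →
      (((b + d : ℕ) : ZMod N) - ((a + d : ℕ) : ZMod N)).val = k := by
    intro k hk h
    have : ((b + d : ℕ) : ZMod N) - ((a + d : ℕ) : ZMod N) = (k : ZMod N) := by
      rw [sub_eq_iff_eq_add, ← Nat.cast_add, add_comm k]
      rcases h with h | h
      · rw [← h, add_zero]
      · rw [← h, Nat.cast_add _ N, ZMod.natCast_self, add_zero]
    rw [this, ZMod.val_natCast, Nat.mod_eq_of_lt hk]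
  split_ifs with h
  · exact key _ (by omega) (by omega)
  · exact key _ (by omega) (by omega)

theorem cast_inj_of_window (hN : 0 < N) {a b : ℕ} (ha : s ≤ a) (ha' : a < s + N) (hb : s ≤ b)
    (hb' : b < s + N) : ((a + d : ℕ) : ZMod N) = ((b + d : ℕ) : ZMod N) ↔ a = b := by
  refine ⟨fun h => ?_, fun h => by rw [h]⟩
  have h₁ := val_sub_cast (d := d) hN ha ha' hb hb'
  rw [h, sub_self, ZMod.val_zero] at h₁
  split_ifs at h₁ <;> omega

theorem exists_window_rep (hN : 0 < N) (s d : ℕ) (z : ZMod N) :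
    ∃ a, s ≤ a ∧ a < s + N ∧ z = ((a + d : ℕ) : ZMod N) := by
  have : NeZero N := ⟨hN.ne'⟩
  refine ⟨s + (z - ((s + d : ℕ) : ZMod N)).val, by omega, ?_, ?_⟩
  · have := ZMod.val_lt (z - ((s + d : ℕ) : ZMod N))
    omega
  · have : s + (z - ((s + d : ℕ) : ZMod N)).val + d = (z - ((s + d : ℕ) : ZMod N)).val + (s + d) := by
      omega
    rw [this, Nat.cast_add _ (s + d), ZMod.natCast_zmod_val, sub_add_cancel]

theorem sym2_window_eq (hN : 0 < N) {a b a' b' : ℕ} (ha : s ≤ a) (hab : a < b) (hb : b < s + N)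
    (ha' : s ≤ a') (hab' : a' < b') (hb' : b' < s + N) :
    s(((a + d : ℕ) : ZMod N), ((b + d : ℕ) : ZMod N)) =
      s(((a' + d : ℕ) : ZMod N), ((b' + d : ℕ) : ZMod N)) ↔ a = a' ∧ b = b' := by
  rw [Sym2.eq_iff, cast_inj_of_window (s := s) hN, cast_inj_of_window (s := s) hN,
    cast_inj_of_window (s := s) hN, cast_inj_of_window (s := s) hN] <;> omega

theorem IsEdge.exists_window (hN : 0 < N) (s d : ℕ) {e : Sym2 (ZMod N)} (he : IsEdge N e) :
    ∃ a b, s ≤ a ∧ a < b ∧ b < s + N ∧ e = s(((a + d : ℕ) : ZMod N), ((b + d : ℕ) : ZMod N)) := by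
  obtain ⟨x, y, rfl, hxy⟩ := he
  obtain ⟨a, ha, ha', rfl⟩ := exists_window_rep hN s d x
  obtain ⟨b, hb, hb', rfl⟩ := exists_window_rep hN s d y
  rcases lt_trichotomy a b with h | h | h
  · exact ⟨a, b, ha, h, hb', rfl⟩
  · exact absurd (by rw [h]) hxy
  · exact ⟨b, a, hb, h, ha', Sym2.eq_swap⟩

theorem cross_window (hN : 0 < N) {a b a' b' : ℕ} (ha : s ≤ a) (hab : a < b) (hb : b < s + N)
    (ha' : s ≤ a') (hab' : a' < b') (hb' : b' < s + N) :
    Cross N s(((a + d : ℕ) : ZMod N), ((b + d : ℕ) : ZMod N))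
      s(((a' + d : ℕ) : ZMod N), ((b' + d : ℕ) : ZMod N)) ↔ LinCross a b a' b' := by
  unfold LinCross
  constructor
  · rintro ⟨x, y, z, w, e₁, e₂, h₁, h₂, h₃⟩
    rw [Sym2.eq_iff] at e₁ e₂
    rcases e₁ with ⟨rfl, rfl⟩ | ⟨rfl, rfl⟩ <;> rcases e₂ with ⟨rfl, rfl⟩ | ⟨rfl, rfl⟩ <;>
    · rw [val_sub_cast (s := s) hN] at h₁ h₂ h₂ h₃ h₃
      any_goals omega
      try split_ifs at h₁ h₂ h₃ <;> omega
  · rintro (h | h)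
    · refine ⟨_, _, _, _, rfl, rfl, ?_⟩
      rw [val_sub_cast (s := s) hN, val_sub_cast (s := s) hN, val_sub_cast (s := s) hN]
      any_goals omega
      split_ifs <;> omega
    · refine ⟨_, _, _, _, rfl, Sym2.eq_swap, ?_⟩
      rw [val_sub_cast (s := s) hN, val_sub_cast (s := s) hN, val_sub_cast (s := s) hN]
      any_goals omega
      split_ifs <;> omega

theorem exists_btw_iff (hN : 0 < N) (x y : ZMod N) : (∃ c, Btw N x c y) ↔ 2 ≤ (y - x).val := by
  have : NeZero N := ⟨hN.ne'⟩
  unfold Btw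
  constructor
  · rintro ⟨c, h₁, h₂⟩
    omega
  · intro h
    have := ZMod.val_lt (y - x)
    refine ⟨x + ((1 : ℕ) : ZMod N), ?_⟩
    rw [add_sub_cancel_left, ZMod.val_natCast, Nat.mod_eq_of_lt (by omega)]
    omega

theorem isDiagonal_window (hN : 0 < N) {a b : ℕ} (ha : s ≤ a) (hab : a < b) (hb : b < s + N) :
    IsDiagonal N s(((a + d : ℕ) : ZMod N), ((b + d : ℕ) : ZMod N)) ↔
      a + 1 < b ∧ b < a + (N - 1) := by
  unfold IsDiagonal
  simp only [exists_btw_iff hN]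
  constructor
  · rintro ⟨x, y, e, -, h₁, h₂⟩
    rw [Sym2.eq_iff] at e
    rcases e with ⟨rfl, rfl⟩ | ⟨rfl, rfl⟩ <;>
    · rw [val_sub_cast (s := s) hN] at h₁ h₂
      any_goals omega
      split_ifs at h₁ h₂ <;> omega
  · intro h
    refine ⟨_, _, rfl, ?_, ?_⟩
    · rw [Ne, cast_inj_of_window (s := s) hN] <;> omega
    · rw [val_sub_cast (s := s) hN, val_sub_cast (s := s) hN]
      any_goals omega
      split_ifs <;> omega

end

theorem IsDiagonal.isEdge {N : ℕ} {e : Sym2 (ZMod N)} (h : IsDiagonal N e) : IsEdge N e := by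
  obtain ⟨a, b, e, h, -⟩ := h
  exact ⟨a, b, e, h⟩

/-- The pair `{p, q}` of labels is a side of the `N`-gon or its edge is not in `D`. -/
def Allow (N d : ℕ) (D : Finset (Sym2 (ZMod N))) (p q : ℕ) : Prop :=
  q = p + 1 ∨ q = p + (N - 1) ∨ s(((p + d : ℕ) : ZMod N), ((q + d : ℕ) : ZMod N)) ∉ D

theorem tri_of_isTriangulation {N : ℕ} (hN : 4 ≤ N) (s d : ℕ) {D T : Finset (Sym2 (ZMod N))}
    (hT : IsTriangulation N T) (hD : Disjoint D T) : Tri (Allow N d D) s (s + (N - 1)) := by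
  obtain ⟨hdiag, hcross, hmax⟩ := hT
  have hN0 : 0 < N := by omega
  set φ : ℕ → ZMod N := fun p => ((p + d : ℕ) : ZMod N) with hφ
  suffices H : ∀ L p q, q = p + L → s ≤ p → p < q → q ≤ s + (N - 1) →
      (q = p + 1 ∨ q = p + (N - 1) ∨ s(φ p, φ q) ∈ T) → Tri (Allow N d D) p q from
    H _ _ _ rfl le_rfl (by omega) le_rfl (Or.inr (Or.inl rfl))
  intro L
  induction L using Nat.strong_induction_on with
  | _ L ih =>
  intro p q hL hp hpq hq hin
  by_cases h1 : q = p + 1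
  · rw [h1]
    exact Tri.side p
  classical
  let good : ℕ → Prop := fun c => p < c ∧ c < q ∧ (c = p + 1 ∨ s(φ p, φ c) ∈ T)
  have hgood : good (p + 1) := ⟨by omega, by omega, Or.inl rfl⟩
  obtain ⟨c, ⟨hpc, hcq, hc⟩, hcmax⟩ : ∃ c, good c ∧ ∀ x, good x → x ≤ c := by
    refine ⟨Nat.findGreatest good q, ?_, fun x hx => ?_⟩
    · exact Nat.findGreatest_spec (P := good) (m := p + 1) (by omega) hgood
    · exact Nat.le_findGreatest hx.2.1.le hx
  have hcq' : q = c + 1 ∨ s(φ c, φ q) ∈ T := by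
    by_contra hcon
    push Not at hcon
    have hd : IsDiagonal N s(φ c, φ q) :=
      (isDiagonal_window (s := s) hN0 (by omega) hcq (by omega)).2 (by omega)
    obtain ⟨f, hf, hfc⟩ := hmax _ hd hcon.2
    obtain ⟨x, y, hx, hxy, hy, rfl⟩ := (hdiag f hf).isEdge.exists_window hN0 s d
    have k₁ := (cross_window (s := s) hN0 (by omega) hcq (by omega) hx hxy hy).1 hfc
    have k₂ : ¬ LinCross p q x y := by
      rcases hin with h | h | h
      · omega
      · unfold LinCross
        omega
      · exact fun hl => hcross _ h _ hf
          ((cross_window (s := s) hN0 (by omega) hpq (by omega) hx hxy hy).2 hl)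
    have k₃ : ¬ LinCross p c x y := by
      rcases hc with h | h
      · unfold LinCross
        omega
      · exact fun hl => hcross _ h _ hf
          ((cross_window (s := s) hN0 (by omega) hpc (by omega) hx hxy hy).2 hl)
    have hxp : x = p ∧ c < y ∧ y < q := by
      unfold LinCross at k₁ k₂ k₃
      omega
    obtain ⟨rfl, hy₁, hy₂⟩ := hxp
    have := hcmax y ⟨hxy, hy₂, Or.inr hf⟩
    omega
  refine Tri.glue ?_ (ih (c - p) (by omega) p c (by omega) hp hpc (by omega) ?_)
    (ih (q - c) (by omega) c q (by omega) (by omega) hcq hq ?_)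
  · rcases hin with h | h | h
    · exact Or.inl h
    · exact Or.inr (Or.inl h)
    · exact Or.inr (Or.inr fun h' => Finset.disjoint_left.1 hD h' h)
  · tauto
  · tauto

theorem exists_isTriangulation_of_tri {N : ℕ} (hN : 4 ≤ N) {s d : ℕ} {D : Finset (Sym2 (ZMod N))}
    (h : Tri (Allow N d D) s (s + (N - 1))) : ∃ T, IsTriangulation N T ∧ Disjoint D T := by
  have hN0 : 0 < N := by omega
  obtain ⟨T, hT, hc, hm, ht⟩ := h.exists_finset
  set φ : ℕ → ZMod N := fun p => ((p + d : ℕ) : ZMod N) with hφ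
  have hmem : ∀ e, e ∈ (T.erase (s, s + (N - 1))).image (fun x => s(φ x.1, φ x.2)) ↔
      ∃ a b, s ≤ a ∧ a + 1 < b ∧ b < a + (N - 1) ∧ b < s + N ∧ (a, b) ∈ T ∧ e = s(φ a, φ b) := by
    intro e
    simp only [Finset.mem_image, Finset.mem_erase, Prod.exists, Ne, Prod.mk.injEq]
    constructor
    · rintro ⟨a, b, ⟨hne, hab⟩, rfl⟩
      have := hT a b hab
      exact ⟨a, b, by omega, by omega, by omega, by omega, hab, rfl⟩
    · rintro ⟨a, b, _, _, _, _, hab, rfl⟩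
      exact ⟨a, b, ⟨by omega, hab⟩, rfl⟩
  refine ⟨(T.erase (s, s + (N - 1))).image (fun x => s(φ x.1, φ x.2)), ⟨?_, ?_, ?_⟩, ?_⟩
  · intro e he
    obtain ⟨a, b, h1, h2, h3, h4, -, rfl⟩ := (hmem e).1 he
    exact (isDiagonal_window hN0 h1 (by omega) h4).2 ⟨h2, h3⟩
  · intro e he f hf
    obtain ⟨a, b, h1, h2, h3, h4, h5, rfl⟩ := (hmem e).1 he
    obtain ⟨a', b', h1', h2', h3', h4', h5', rfl⟩ := (hmem f).1 hf
    rw [cross_window hN0 h1 (by omega) h4 h1' (by omega) h4']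
    exact hc _ _ _ _ h5 h5'
  · intro e he hne
    obtain ⟨a, b, ha, hab, hb, rfl⟩ := he.isEdge.exists_window hN0 s d
    obtain ⟨h1, h2⟩ := (isDiagonal_window hN0 ha hab hb).1 he
    have hnT : (a, b) ∉ T := fun hin => hne ((hmem _).2 ⟨a, b, ha, h1, h2, hb, hin, rfl⟩)
    obtain ⟨x, y, hxy, hl⟩ := hm a b ha h1 (by omega) hnT
    have := hT x y hxy
    refine ⟨s(φ x, φ y), (hmem _).2 ⟨x, y, by omega, by omega, ?_, by omega, hxy, rfl⟩, ?_⟩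
    · unfold LinCross at hl
      omega
    · exact (cross_window (s := s) hN0 ha hab hb (by omega) (by omega) (by omega)).2 hl
  · rw [Finset.disjoint_right]
    intro e he
    obtain ⟨a, b, h1, h2, h3, h4, h5, rfl⟩ := (hmem e).1 he
    rcases (hT a b h5).2.2.2 with h | h | h
    · omega
    · omega
    · exact h

/-- A set of edges blocks the `N`-gon iff the polygon, cut open at any place, has no triangulation
avoiding the set. -/
theorem isBlocker_iff_not_tri {N : ℕ} (hN : 4 ≤ N) (s d : ℕ) {D : Finset (Sym2 (ZMod N))}
    (hD : ∀ e ∈ D, IsEdge N e) :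
    IsBlocker N D ↔ ¬ Tri (Allow N d D) s (s + (N - 1)) := by
  constructor
  · rintro ⟨-, h⟩ ht
    obtain ⟨T, hT, hdis⟩ := exists_isTriangulation_of_tri hN ht
    exact (Finset.nonempty_iff_ne_empty.1 (h T hT)) (Finset.disjoint_iff_inter_eq_empty.1 hdis)
  · intro h
    refine ⟨hD, fun T hT => ?_⟩
    rw [Finset.nonempty_iff_ne_empty]
    exact fun he => h (tri_of_isTriangulation hN s d hT (Finset.disjoint_iff_inter_eq_empty.2 he))

end ConvexBlocker

namespace ConvexBlocker

section

variable {n m i : ℕ} {F : ℕ → ℕ} {x y : ℕ}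

/-- The criterion `Crit` when the forbidden edges at the inserted vertex end in `x` and `y`. -/
def Free (n m i : ℕ) (F : ℕ → ℕ) (x y : ℕ) : Prop :=
  ∃ u q t q', i < u ∧ u ≤ n ∧ m + 2 ≤ t ∧ t ≤ i ∧ 1 ≤ q ∧ q < F u ∧ F t < q' ∧ q' ≤ m + 1 ∧
    (u = i + 1 ∨ (u ≠ x ∧ u ≠ y)) ∧ (t = i ∨ (n + t ≠ x ∧ n + t ≠ y)) ∧
    (x < n + q ∨ n + q' < x) ∧ (y < n + q ∨ n + q' < y)

theorem free_comm : Free n m i F x y ↔ Free n m i F y x := by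
  unfold Free
  constructor <;> rintro ⟨u, q, t, q', h⟩ <;> exact ⟨u, q, t, q', by tauto⟩

theorem crit_iff_free (hF : BeamData n m i F) :
    Crit n m i F (fun p => p = i + 1 ∨ p = n + i ∨ (p ≠ x ∧ p ≠ y)) ↔ Free n m i F x y := by
  have := hF.i_lt
  have := hF.le_i
  unfold Crit Free
  refine exists_congr fun u => exists_congr fun q => exists_congr fun t => exists_congr fun q' => ?_
  constructor
  · rintro ⟨h1, h2, h3, h4, h5, h6, h7, h8, h9, h10, h11⟩
    refine ⟨h1, h2, h3, h4, h5, h6, h7, h8, by omega, by omega, ?_, ?_⟩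
    · by_contra! hx
      have := h11 (x - n) (by omega) (by omega)
      omega
    · by_contra! hy
      have := h11 (y - n) (by omega) (by omega)
      omega
  · rintro ⟨h1, h2, h3, h4, h5, h6, h7, h8, h9, h10, h11, h12⟩
    exact ⟨h1, h2, h3, h4, h5, h6, h7, h8, by omega, by omega, fun w _ _ => by omega⟩

/-- The beam at `i` is crossed by exactly one beam, ending in `F i - 1`. -/
def LeftSit (n m i : ℕ) (F : ℕ → ℕ) (x y : ℕ) : Prop :=
  ∃ k, m + 2 < k ∧ k < i ∧ F k + 1 = F i ∧ (∀ k', m + 2 < k' → k' < i → F k' < F i → k' = k) ∧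
    ((x = n + k ∧ y = n + F i + 1) ∨ (y = n + k ∧ x = n + F i + 1))

/-- The beam at `i + 1` is crossed by exactly one beam, ending in `F (i + 1) + 1`. -/
def RightSit (n i : ℕ) (F : ℕ → ℕ) (x y : ℕ) : Prop :=
  ∃ k, i + 1 < k ∧ k < n ∧ F k = F (i + 1) + 1 ∧
    (∀ k', i + 1 < k' → k' < n → F (i + 1) < F k' → k' = k) ∧
    ((x = k ∧ y + 1 = n + F (i + 1)) ∨ (y = k ∧ x + 1 = n + F (i + 1)))

theorem leftSit_comm : LeftSit n m i F x y ↔ LeftSit n m i F y x := by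
  unfold LeftSit
  constructor <;> rintro ⟨k, h⟩ <;> exact ⟨k, by tauto⟩

theorem rightSit_comm : RightSit n i F x y ↔ RightSit n i F y x := by
  unfold RightSit
  constructor <;> rintro ⟨k, h⟩ <;> exact ⟨k, by tauto⟩

theorem leftSit_of_lt (hF : BeamData n m i F) (hxy : x < y) (hy : y ≤ n + i)
    (hx₁ : n + F i < x) (hno : ¬ Free n m i F x y) (hfx : Free n m i F x x) :
    LeftSit n m i F x y := by
  have := hF.i_lt
  have := hF.le_i
  have := hF.left_end
  have := hF.right_end
  have := hF.one_le_m
  have hle := hF.le i (by omega) (by omega)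
  have hpos := hF.pos i (by omega) (by omega)
  obtain ⟨u, q, t, q', h1, h2, h3, h4, h5, h6, h7, h8, h9, h10, h11, -⟩ := hfx
  have hju := hF.jump i u (by omega) (by omega) (by omega)
  have hjt : t = i ∨ F i ≤ F t + 1 := by
    rcases h4.lt_or_eq with h | h
    · exact Or.inr (hF.jump t i (by omega) h (by omega))
    · exact Or.inl h
  have hhit : ∀ t q', m + 2 ≤ t → t ≤ i → F t < q' → q' ≤ m + 1 →
      ¬ (t = i ∨ (n + t ≠ x ∧ n + t ≠ y)) ∨ x ≤ n + q' ∨ y ≤ n + q' := by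
    intro t q' k1 k2 k3 k4
    by_contra! hcon
    exact hno ⟨u, q, t, q', h1, h2, k1, k2, h5, h6, k3, k4, by omega, by tauto, by omega, by omega⟩
  have hti : F t = F i ∨ t ≠ i := by
    rcases eq_or_ne t i with rfl | h
    · exact Or.inl rfl
    · exact Or.inr h
  have hq' : n + q' < x := by omega
  have hty : n + t = y := by
    have := hhit t q' h3 h4 h7 h8
    omega
  have hti' : t < i := by
    by_contra h
    have := hhit t q' h3 h4 h7 h8
    omega
  by_cases ha : F i ≤ m
  · have := hhit i (F i + 1) (by omega) le_rfl (by omega) (by omega)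
    have htm : t ≠ m + 2 := by
      rintro rfl
      omega
    refine ⟨t, by omega, hti', by omega, fun k' hk₁ hk₂ hk₃ => ?_, by omega⟩
    have := hhit k' (F i) (by omega) (by omega) hk₃ (by omega)
    omega
  · have := hhit (m + 2) (m + 1) le_rfl (by omega) (by omega) le_rfl
    refine ⟨t, by omega, hti', by omega, fun k' hk₁ hk₂ hk₃ => ?_, by omega⟩
    have := hhit k' (m + 1) (by omega) (by omega) (by omega) le_rfl
    omega

theorem rightSit_of_lt (hF : BeamData n m i F) (hyx : y < x) (hy : i < y)
    (hx₁ : x < n + F (i + 1)) (hno : ¬ Free n m i F x y) (hfx : Free n m i F x x) :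
    RightSit n i F x y := by
  have := hF.i_lt
  have := hF.le_i
  have := hF.left_end
  have hrn := hF.right_end
  have := hF.one_le_m
  have hle := hF.le (i + 1) (by omega) (by omega)
  have hpos := hF.pos (i + 1) (by omega) (by omega)
  obtain ⟨u, q, t, q', h1, h2, h3, h4, h5, h6, h7, h8, h9, h10, h11, -⟩ := hfx
  have hjt := hF.jump t (i + 1) (by omega) (by omega) (by omega)
  have hju : u = i + 1 ∨ F u ≤ F (i + 1) + 1 := by
    rcases Nat.lt_or_ge (i + 1) u with h | h
    · exact Or.inr (hF.jump (i + 1) u (by omega) h (by omega))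
    · exact Or.inl (by omega)
  have hhit : ∀ u q, i < u → u ≤ n → 1 ≤ q → q < F u →
      ¬ (u = i + 1 ∨ (u ≠ x ∧ u ≠ y)) ∨ n + q ≤ x ∨ n + q ≤ y := by
    intro u q k1 k2 k3 k4
    by_contra! hcon
    exact hno ⟨u, q, t, q', k1, k2, h3, h4, k3, k4, h7, h8, by tauto, by omega, by omega, by omega⟩
  have hui : F u = F (i + 1) ∨ u ≠ i + 1 := by
    rcases eq_or_ne u (i + 1) with rfl | h
    · exact Or.inl rfl
    · exact Or.inr h
  have hq' : x < n + q := by omega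
  have huy : u = y := by
    have := hhit u q h1 h2 h5 h6
    omega
  have hui' : i + 1 < u := by
    by_contra h
    have := hhit u q h1 h2 h5 h6
    omega
  by_cases ha : 2 ≤ F (i + 1)
  · have := hhit (i + 1) (F (i + 1) - 1) (by omega) (by omega) (by omega) (by omega)
    have hun : u ≠ n := by
      rintro rfl
      omega
    refine ⟨u, hui', by omega, by omega, fun k' hk₁ hk₂ hk₃ => ?_, by omega⟩
    have := hhit k' (F (i + 1)) (by omega) (by omega) (by omega) hk₃
    omega
  · have := hhit n 1 (by omega) le_rfl le_rfl (by omega)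
    refine ⟨u, hui', by omega, by omega, fun k' hk₁ hk₂ hk₃ => ?_, by omega⟩
    have := hhit k' 1 (by omega) (by omega) le_rfl (by omega)
    omega

/-- A label missed by some admissible choice lies outside the beams at `i` and `i + 1`. -/
theorem Free.outside (hF : BeamData n m i F) (h : Free n m i F x x) :
    (n + F i < x ∧ n + F (i + 1) < x) ∨ (x < n + F i ∧ x < n + F (i + 1)) := by
  have := hF.i_lt
  have := hF.le_i
  obtain ⟨u, q, t, q', h1, h2, h3, h4, h5, h6, h7, h8, h9, h10, h11, -⟩ := h
  have := hF.jump i u (by omega) (by omega) (by omega)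
  have := hF.jump t (i + 1) (by omega) (by omega) (by omega)
  have : F u = F (i + 1) ∨ F u ≤ F (i + 1) + 1 := by
    rcases Nat.lt_or_ge (i + 1) u with h | h
    · exact Or.inr (hF.jump (i + 1) u (by omega) h (by omega))
    · exact Or.inl (by rw [show u = i + 1 by omega])
  have : F t = F i ∨ F i ≤ F t + 1 := by
    rcases h4.lt_or_eq with h | h
    · exact Or.inr (hF.jump t i (by omega) h (by omega))
    · exact Or.inl (by rw [h])
  omega

/-- Obstructions on different sides of the beams at `i` and `i + 1` can be avoided together. -/
theorem Free.combine (hF : BeamData n m i F) (hx : x < n + F (i + 1)) (hy : n + F i < y)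
    (hfx : Free n m i F x x) (hfy : Free n m i F y y) : Free n m i F x y := by
  have := hF.i_lt
  have := hF.le_i
  have := hF.le (i + 1) (by omega) (by omega)
  have := hF.pos i (by omega) (by omega)
  obtain ⟨u, q, t', r', h1, h2, g3, g4, h5, h6, g7, g8, h9, g10, h11, -⟩ := hfx
  obtain ⟨u', r, t, q', k1, k2, h3, h4, k5, k6, h7, h8, k9, h10, k11, -⟩ := hfy
  have := hF.jump i u (by omega) (by omega) (by omega)
  have := hF.jump t' (i + 1) (by omega) (by omega) (by omega)
  have := hF.jump t (i + 1) (by omega) (by omega) (by omega)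
  have := hF.jump i u' (by omega) (by omega) (by omega)
  exact ⟨u, q, t, q', h1, h2, h3, h4, h5, h6, h7, h8, by omega, by omega, by omega, by omega⟩

theorem LeftSit.free (hF : BeamData n m i F) (h : LeftSit n m i F x y) :
    ¬ Free n m i F x y ∧ Free n m i F x x ∧ Free n m i F y y := by
  have := hF.i_lt
  have := hF.le_i
  have := hF.left_end
  have := hF.right_end
  have := hF.one_le_m
  have := hF.le i (by omega) (by omega)
  have key : ∀ x y k, m + 2 < k → k < i → F k + 1 = F i →
      (∀ k', m + 2 < k' → k' < i → F k' < F i → k' = k) → x = n + k → y = n + F i + 1 →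
      ¬ Free n m i F x y ∧ Free n m i F x x ∧ Free n m i F y y := by
    intro x y k hk₁ hk₂ hk₃ hu hx hy
    refine ⟨?_, ?_, ?_⟩
    · rintro ⟨u, q, t, q', h1, h2, h3, h4, h5, h6, h7, h8, h9, h10, h11, h12⟩
      have := hF.jump i u (by omega) (by omega) (by omega)
      have hti : t ≠ i := by
        rintro rfl
        omega
      have htm : t ≠ m + 2 := by
        rintro rfl
        omega
      have := hu t (by omega) (by omega) (by omega)
      omega
    · by_cases ha : F i ≤ m
      · exact ⟨n, 1, i, F i + 1, by omega, le_rfl, by omega, le_rfl, le_rfl, by omega, by omega,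
          by omega, by omega, by omega, by omega, by omega⟩
      · exact ⟨n, 1, m + 2, m + 1, by omega, le_rfl, by omega, by omega, le_rfl, by omega, by omega,
          by omega, by omega, by omega, by omega, by omega⟩
    · exact ⟨n, 1, k, F i, by omega, le_rfl, by omega, by omega, le_rfl, by omega, by omega,
        by omega, by omega, by omega, by omega, by omega⟩
  obtain ⟨k, hk₁, hk₂, hk₃, hu, ⟨hx, hy⟩ | ⟨hy, hx⟩⟩ := h
  · exact key x y k hk₁ hk₂ hk₃ hu hx hy
  · rw [free_comm, and_comm (a := Free n m i F x x)]
    exact key y x k hk₁ hk₂ hk₃ hu hy hx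

theorem RightSit.free (hF : BeamData n m i F) (h : RightSit n i F x y) :
    ¬ Free n m i F x y ∧ Free n m i F x x ∧ Free n m i F y y := by
  have := hF.i_lt
  have := hF.le_i
  have := hF.left_end
  have := hF.right_end
  have := hF.one_le_m
  have := hF.pos (i + 1) (by omega) (by omega)
  have key : ∀ x y k, i + 1 < k → k < n → F k = F (i + 1) + 1 →
      (∀ k', i + 1 < k' → k' < n → F (i + 1) < F k' → k' = k) → x = k → y + 1 = n + F (i + 1) →
      ¬ Free n m i F x y ∧ Free n m i F x x ∧ Free n m i F y y := by
    intro x y k hk₁ hk₂ hk₃ hu hx hy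
    have := hF.le k (by omega) (by omega)
    refine ⟨?_, ?_, ?_⟩
    · rintro ⟨u, q, t, q', h1, h2, h3, h4, h5, h6, h7, h8, h9, h10, h11, h12⟩
      have := hF.jump t (i + 1) (by omega) (by omega) (by omega)
      have hui : u ≠ i + 1 := by
        rintro rfl
        omega
      have hun : u ≠ n := by
        rintro rfl
        omega
      have := hu u (by omega) (by omega) (by omega)
      omega
    · by_cases ha : 2 ≤ F (i + 1)
      · exact ⟨i + 1, F (i + 1) - 1, m + 2, m + 1, by omega, by omega, le_rfl, by omega, by omega,
          by omega, by omega, le_rfl, by omega, by omega, by omega, by omega⟩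
      · exact ⟨n, 1, m + 2, m + 1, by omega, le_rfl, le_rfl, by omega, le_rfl,
          by omega, by omega, le_rfl, by omega, by omega, by omega, by omega⟩
    · exact ⟨k, F (i + 1), m + 2, m + 1, by omega, by omega, le_rfl, by omega, by omega,
        by omega, by omega, le_rfl, by omega, by omega, by omega, by omega⟩
  obtain ⟨k, hk₁, hk₂, hk₃, hu, ⟨hx, hy⟩ | ⟨hy, hx⟩⟩ := h
  · exact key x y k hk₁ hk₂ hk₃ hu hx hy
  · rw [free_comm, and_comm (a := Free n m i F x x)]
    exact key y x k hk₁ hk₂ hk₃ hu hy hx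

theorem free_iff_sit (hF : BeamData n m i F) (hxy : x ≠ y) (hx : i < x) (hx' : x ≤ n + i)
    (hy : i < y) (hy' : y ≤ n + i) :
    (¬ Free n m i F x y ∧ Free n m i F x x ∧ Free n m i F y y) ↔
      LeftSit n m i F x y ∨ RightSit n i F x y := by
  refine ⟨?_, fun h => h.elim (LeftSit.free hF) (RightSit.free hF)⟩
  rintro ⟨hno, hfx, hfy⟩
  have hno' : ¬ Free n m i F y x := fun h => hno (free_comm.1 h)
  rcases hfx.outside hF with ox | ox <;> rcases hfy.outside hF with oy | oy
  · left
    rcases lt_or_gt_of_ne hxy with h | h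
    · exact leftSit_of_lt hF h hy' ox.1 hno hfx
    · exact leftSit_comm.1 (leftSit_of_lt hF h hx' oy.1 hno' hfy)
  · exact absurd (Free.combine hF oy.2 ox.1 hfy hfx) hno'
  · exact absurd (Free.combine hF ox.2 oy.1 hfx hfy) hno
  · right
    rcases lt_or_gt_of_ne hxy with h | h
    · exact rightSit_comm.1 (rightSit_of_lt hF h hx oy.2 hno' hfy)
    · exact rightSit_of_lt hF h hy ox.2 hno hfx

end

end ConvexBlocker

namespace ConvexBlocker

/-- The inner end of the beam at the outer vertex `j`, with the conventions of `BeamData` at the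
ends of the boundary net. -/
def beamEnd (n m : ℕ) (idx : ℕ → ℕ) (j : ℕ) : ℕ :=
  if j = n then 2 else if j = m + 2 then m else idx (j - (m + 2))

section

variable {n m i : ℕ} {idx : ℕ → ℕ} {B : Finset (Sym2 (ZMod n))}

theorem beamEnd_add {j : ℕ} (hj : 1 ≤ j) (hj' : m + 2 + j < n) :
    beamEnd n m idx (m + 2 + j) = idx j := by
  unfold beamEnd
  rw [if_neg (by omega), if_neg (by omega), Nat.add_sub_cancel_left]

theorem natCast_add_left_self (n a : ℕ) : ((n + a : ℕ) : ZMod n) = (a : ZMod n) := by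
  simp

theorem cross_beams {a b a' b' : ℕ} (hab : a < b) (hb : b < n) (hab' : a' < b') (hb' : b' < n) :
    Cross n s((b : ZMod n), (a : ZMod n)) s((b' : ZMod n), (a' : ZMod n)) ↔ LinCross a b a' b' := by
  rw [Sym2.eq_swap (a := (b : ZMod n)), Sym2.eq_swap (a := (b' : ZMod n))]
  exact cross_window (s := 0) (d := 0) (by omega) (by omega) hab (by omega) (by omega) hab'
    (by omega)

theorem StdForm.beamData (hn : 7 ≤ n) (h : StdForm n m idx B) (hi₁ : m + 2 ≤ i)
    (hi₂ : i ≤ n - 1) : BeamData n m i (beamEnd n m idx) := by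
  obtain ⟨hm, hm', hidx, -, hcr⟩ := h
  have hr : beamEnd n m idx n = 2 := by simp [beamEnd]
  have hl : beamEnd n m idx (m + 2) = m := by
    unfold beamEnd
    rw [if_neg (by omega), if_pos rfl]
  have hb : ∀ j, m + 2 ≤ j → j ≤ n → 1 ≤ beamEnd n m idx j ∧ beamEnd n m idx j ≤ m + 1 := by
    intro j h₁ h₂
    rcases eq_or_ne j n with rfl | hjn
    · omega
    rcases eq_or_ne j (m + 2) with rfl | hjm
    · omega
    obtain ⟨k, rfl⟩ := Nat.exists_eq_add_of_le h₁
    rw [beamEnd_add (by omega) (by omega)]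
    exact hidx k (Finset.mem_Icc.2 (by omega))
  refine ⟨hm, hi₁, by omega, hr, hl, fun j h₁ h₂ => (hb j h₁ h₂).1, fun j h₁ h₂ => (hb j h₁ h₂).2, ?_⟩
  intro t u ht htu hu
  have h₁ := hb t ht (by omega)
  have h₂ := hb u (by omega) hu
  rcases eq_or_ne u n with rfl | hun
  · omega
  rcases eq_or_ne t (m + 2) with rfl | htm
  · omega
  obtain ⟨j, rfl⟩ := Nat.exists_eq_add_of_le ht
  obtain ⟨k, rfl⟩ := Nat.exists_eq_add_of_le (show m + 2 ≤ u by omega)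
  rw [beamEnd_add (by omega) (by omega)] at h₁ h₂ ⊢
  rw [beamEnd_add (by omega) (by omega)]
  by_contra! hcon
  refine hcr j (Finset.mem_Icc.2 (by omega)) k (Finset.mem_Icc.2 (by omega)) (Or.inl (by omega)) ?_
  rw [cross_beams (by omega) (by omega) (by omega) (by omega)]
  exact Or.inl (by omega)

theorem unrolled_eq_iff (hin : i < n) {p q p' q' : ℕ} (hp : i < p) (hpq : p < q)
    (hq : q ≤ n + i) (hp' : i < p') (hpq' : p' < q') (hq' : q' ≤ n + i) :
    s((p : ZMod n), (q : ZMod n)) = s((p' : ZMod n), (q' : ZMod n)) ↔ p = p' ∧ q = q' :=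
  sym2_window_eq (s := i + 1) (d := 0) (by omega) hp hpq (by omega) hp' hpq' (by omega)

theorem StdForm.mem_iff_bad (h : StdForm n m idx B)
    (hF : BeamData n m i (beamEnd n m idx)) {p q : ℕ} (hp : i < p) (hpq : p < q) (hq : q ≤ n + i) :
    s((p : ZMod n), (q : ZMod n)) ∈ B ↔ Bad n m i (beamEnd n m idx) p q := by
  have hin := hF.i_lt
  have hmi := hF.le_i
  obtain ⟨-, -, -, rfl, -⟩ := h
  simp only [Finset.mem_union, Finset.mem_image, Finset.mem_range, Finset.mem_Icc]
  have net : ∀ j : ℕ, j ≤ m → (s((j : ZMod n), ((j + 2 : ℕ) : ZMod n)) =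
      s((p : ZMod n), (q : ZMod n)) ↔ p = n + j ∧ q = n + (j + 2)) := by
    intro j hj
    rw [← natCast_add_left_self n j, ← natCast_add_left_self n (j + 2), eq_comm]
    exact unrolled_eq_iff hin hp hpq hq (by omega) (by omega) (by omega)
  have beam : ∀ u : ℕ, m + 2 < u → u < n → (s((u : ZMod n), (beamEnd n m idx u : ZMod n)) =
      s((p : ZMod n), (q : ZMod n)) ↔ (i < u ∧ p = u ∧ q = n + beamEnd n m idx u) ∨
        (u ≤ i ∧ p = n + beamEnd n m idx u ∧ q = n + u)) := by
    intro u hu hu'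
    have h₁ := hF.pos u (by omega) (by omega)
    have h₂ := hF.le u (by omega) (by omega)
    rw [← natCast_add_left_self n (beamEnd n m idx u)]
    rcases Nat.lt_or_ge i u with hiu | hiu
    · rw [eq_comm, unrolled_eq_iff hin hp hpq hq (by omega) (by omega) (by omega)]
      omega
    · rw [← natCast_add_left_self n u, Sym2.eq_swap, eq_comm,
        unrolled_eq_iff hin hp hpq hq (by omega) (by omega) (by omega)]
      omega
  constructor
  · rintro (⟨j, hj, hj'⟩ | ⟨j, hj, hj'⟩)
    · rw [net j (by omega)] at hj'
      exact Or.inl (by omega)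
    · rw [← beamEnd_add (n := n) (m := m) (idx := idx) hj.1 (by omega), beam _ (by omega) (by omega)] at hj'
      rcases hj' with ⟨h₁, rfl, h₂⟩ | ⟨h₁, h₂, rfl⟩
      · exact Or.inr (Or.inl (by omega))
      · refine Or.inr (Or.inr ⟨by omega, by omega, ?_⟩)
        rwa [Nat.add_sub_cancel_left]
  · rintro (h | h | h)
    · exact Or.inl ⟨p - n, by omega, (net _ (by omega)).2 (by omega)⟩
    · obtain ⟨j, rfl⟩ := Nat.exists_eq_add_of_le (show m + 2 ≤ p by omega)
      refine Or.inr ⟨j, by omega, ?_⟩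
      rw [← beamEnd_add (n := n) (m := m) (idx := idx) (j := j) (by omega) (by omega)]
      exact (beam _ (by omega) (by omega)).2 (Or.inl ⟨hp, rfl, h.2.2⟩)
    · obtain ⟨j, rfl⟩ := Nat.exists_eq_add_of_le (show n + (m + 2) ≤ q by omega)
      rw [show n + (m + 2) + j - n = m + 2 + j by omega] at h
      refine Or.inr ⟨j, by omega, ?_⟩
      rw [← beamEnd_add (n := n) (m := m) (idx := idx) (j := j) (by omega) (by omega)]
      exact (beam _ (by omega) (by omega)).2 (Or.inr ⟨by omega, h.2.2, by omega⟩)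

theorem insVx_natCast (hin : i < n) {p : ℕ} (hp : i < p) (hp' : p ≤ n + i) :
    insVx n i (p : ZMod n) = ((p + 1 : ℕ) : ZMod (n + 1)) := by
  unfold insVx
  rw [ZMod.val_natCast]
  rcases Nat.lt_or_ge p n with h | h
  · rw [Nat.mod_eq_of_lt h, if_neg (by omega)]
  · obtain ⟨k, rfl⟩ := Nat.exists_eq_add_of_le h
    rw [Nat.add_mod_left, Nat.mod_eq_of_lt (by omega), if_pos (by omega),
      show n + k + 1 = (n + 1) + k by omega, natCast_add_left_self]

theorem insVx_injective (hin : i < n) : Function.Injective (insVx n i) := by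
  intro a b hab
  obtain ⟨p, hp, hp', rfl⟩ := exists_window_rep (by omega) (i + 1) 0 a
  obtain ⟨q, hq, hq', rfl⟩ := exists_window_rep (by omega) (i + 1) 0 b
  simp only [add_zero] at hab ⊢
  rw [insVx_natCast hin (by omega) (by omega), insVx_natCast hin (by omega) (by omega),
    cast_inj_of_window (s := i) (by omega) (by omega) (by omega) (by omega) (by omega)] at hab
  rw [hab]

theorem insEdge_injective (hin : i < n) : Function.Injective (insEdge n i) :=
  Sym2.map.injective (insVx_injective hin)

theorem insEdge_natCast (hin : i < n) {p q : ℕ} (hp : i < p) (hpq : p < q) (hq : q ≤ n + i) :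
    insEdge n i s((p : ZMod n), (q : ZMod n)) =
      s(((p + 1 : ℕ) : ZMod (n + 1)), ((q + 1 : ℕ) : ZMod (n + 1))) := by
  unfold insEdge
  rw [Sym2.map_mk, insVx_natCast hin hp (by omega), insVx_natCast hin (by omega) hq]

theorem mem_image_insEdge (hin : i < n) {p q : ℕ} (hp : i < p) (hpq : p < q) (hq : q ≤ n + i) :
    s(((p + 1 : ℕ) : ZMod (n + 1)), ((q + 1 : ℕ) : ZMod (n + 1))) ∈ B.image (insEdge n i) ↔
      s((p : ZMod n), (q : ZMod n)) ∈ B := by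
  rw [← insEdge_natCast hin hp hpq hq]
  exact (insEdge_injective hin).mem_finset_image

theorem isEdge_insEdge (hin : i < n) {e : Sym2 (ZMod n)} (he : IsEdge n e) :
    IsEdge (n + 1) (insEdge n i e) := by
  obtain ⟨a, b, rfl, hab⟩ := he
  exact ⟨_, _, rfl, fun h => hab (insVx_injective hin h)⟩

/-- The edge of the `(n + 1)`-gon joining the inserted vertex to the vertex with unrolled
label `x`. -/
def newEdge (n i x : ℕ) : Sym2 (ZMod (n + 1)) :=
  s(((i + 1 : ℕ) : ZMod (n + 1)), ((x + 1 : ℕ) : ZMod (n + 1)))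

theorem newEdge_inj {x y : ℕ} (hx : i < x) (hx' : x ≤ n + i) (hy : i < y) (hy' : y ≤ n + i) :
    newEdge n i x = newEdge n i y ↔ x = y := by
  unfold newEdge
  rw [sym2_window_eq (s := i) (by omega) (by omega) (by omega) (by omega) (by omega) (by omega)
    (by omega)]
  simp

theorem isEdge_newEdge {x : ℕ} (hx : i < x) (hx' : x ≤ n + i) : IsEdge (n + 1) (newEdge n i x) := by
  refine ⟨_, _, rfl, ?_⟩
  rw [Ne, cast_inj_of_window (s := i)] <;> omega

theorem IsEdge.exists_newEdge {e : Sym2 (ZMod (n + 1))} (he : IsEdge (n + 1) e)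
    (hv : ((i + 1 : ℕ) : ZMod (n + 1)) ∈ e) : ∃ x, i < x ∧ x ≤ n + i ∧ e = newEdge n i x := by
  obtain ⟨a, b, ha, hab, hb, rfl⟩ := he.exists_window (by omega) i 1
  rw [Sym2.mem_iff, cast_inj_of_window (s := i) (by omega) (by omega) (by omega) (by omega) (by omega),
    cast_inj_of_window (s := i) (by omega) (by omega) (by omega) (by omega) (by omega)] at hv
  obtain rfl : i = a := by omega
  exact ⟨b, hab, by omega, rfl⟩

theorem newEdge_ne {p q x : ℕ} (hp : i < p) (hpq : p < q) (hq : q ≤ n + i) (hx : i < x)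
    (hx' : x ≤ n + i) :
    s(((p + 1 : ℕ) : ZMod (n + 1)), ((q + 1 : ℕ) : ZMod (n + 1))) ≠ newEdge n i x := by
  unfold newEdge
  rw [Ne, sym2_window_eq (s := i) (by omega) (by omega) (by omega) (by omega) (by omega) (by omega)
    (by omega)]
  omega

theorem newEdge_notMem_image (hin : i < n) (hB : ∀ e ∈ B, IsEdge n e) {x : ℕ} (hx : i < x)
    (hx' : x ≤ n + i) : newEdge n i x ∉ B.image (insEdge n i) := by
  intro h
  obtain ⟨e, he, heq⟩ := Finset.mem_image.1 h
  obtain ⟨p, q, hp, hpq, hq, rfl⟩ := (hB e he).exists_window (by omega) (i + 1) 0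
  simp only [add_zero] at heq
  rw [insEdge_natCast hin (by omega) hpq (by omega)] at heq
  exact newEdge_ne (by omega) hpq (by omega) hx hx' heq

theorem isBlocker_insert_iff_not_free (hn : 7 ≤ n) (hB : ∀ e ∈ B, IsEdge n e)
    (h : StdForm n m idx B) (hF : BeamData n m i (beamEnd n m idx)) {x y : ℕ} (hx : i < x)
    (hx' : x ≤ n + i) (hy : i < y) (hy' : y ≤ n + i) :
    IsBlocker (n + 1) (B.image (insEdge n i) ∪ {newEdge n i x, newEdge n i y}) ↔
      ¬ Free n m i (beamEnd n m idx) x y := by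
  have hin := hF.i_lt
  have hmi := hF.le_i
  have hedge : ∀ e ∈ B.image (insEdge n i) ∪ {newEdge n i x, newEdge n i y}, IsEdge (n + 1) e := by
    intro e he
    simp only [Finset.mem_union, Finset.mem_image, Finset.mem_insert, Finset.mem_singleton] at he
    rcases he with ⟨e, he, rfl⟩ | rfl | rfl
    · exact isEdge_insEdge hin (hB e he)
    · exact isEdge_newEdge hx hx'
    · exact isEdge_newEdge hy hy'
  rw [isBlocker_iff_not_tri (by omega) i 1 hedge, Nat.add_sub_cancel, add_comm i n, not_iff_not,
    ← crit_iff_free hF, tri_iff_crit _ hF (Or.inl rfl) (Or.inr (Or.inl (by omega)))]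
  · have key : ∀ p, i < p → p ≤ n + i →
        (Allow (n + 1) 1 (B.image (insEdge n i) ∪ {newEdge n i x, newEdge n i y}) i p ↔
          p = i + 1 ∨ p = n + i ∨ (p ≠ x ∧ p ≠ y)) := by
      intro p hp hp'
      unfold Allow
      change _ ∨ _ ∨ newEdge n i p ∉ _ ↔ _
      rw [Nat.add_sub_cancel, add_comm i n, Finset.mem_union, Finset.mem_insert,
        Finset.mem_singleton, newEdge_inj hp hp' hx hx', newEdge_inj hp hp' hy hy']
      have := newEdge_notMem_image hin hB hp hp'
      tauto
    unfold Crit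
    refine exists_congr fun u => exists_congr fun q => exists_congr fun t => exists_congr fun q' => ?_
    constructor
    · rintro ⟨h1, h2, h3, h4, h5, h6, h7, h8, h9, h10, h11⟩
      exact ⟨h1, h2, h3, h4, h5, h6, h7, h8, (key _ (by omega) (by omega)).1 h9,
        (key _ (by omega) (by omega)).1 h10,
        fun w k₁ k₂ => (key _ (by omega) (by omega)).1 (h11 w k₁ k₂)⟩
    · rintro ⟨h1, h2, h3, h4, h5, h6, h7, h8, h9, h10, h11⟩
      exact ⟨h1, h2, h3, h4, h5, h6, h7, h8, (key _ (by omega) (by omega)).2 h9,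
        (key _ (by omega) (by omega)).2 h10,
        fun w k₁ k₂ => (key _ (by omega) (by omega)).2 (h11 w k₁ k₂)⟩
  · intro p q hp hpq hq
    unfold Allow
    rw [Finset.mem_union, Finset.mem_insert, Finset.mem_singleton,
      mem_image_insEdge hin hp hpq hq, h.mem_iff_bad hF hp hpq hq]
    have n₁ := newEdge_ne hp hpq hq hx hx'
    have n₂ := newEdge_ne hp hpq hq hy hy'
    have hside : q = p + 1 → ¬ Bad n m i (beamEnd n m idx) p q := by
      rintro rfl (hb | hb | hb)
      · omega
      · have := hF.pos p (by omega) (by omega)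
        omega
      · have := hF.le (p + 1 - n) (by omega) (by omega)
        omega
    have hlong : q ≠ p + (n + 1 - 1) := by omega
    tauto

/-- An old edge remains indispensable: a triangulation meeting the blocker in that edge only
extends over the inserted vertex. -/
theorem not_isBlocker_erase_insEdge (hn : 7 ≤ n) (hin : i < n) (hB : ∀ e ∈ B, IsEdge n e)
    {e : Sym2 (ZMod n)} (hne : ¬ IsBlocker n (B.erase e)) {x y : ℕ} (hx : i < x)
    (hx' : x ≤ n + i) (hy : i < y) (hy' : y ≤ n + i)
    (hlong : s(((i + 1 : ℕ) : ZMod n), ((n + i : ℕ) : ZMod n)) ∉ B) :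
    ¬ IsBlocker (n + 1)
      ((B.image (insEdge n i) ∪ {newEdge n i x, newEdge n i y}).erase (insEdge n i e)) := by
  rintro hb
  rw [isBlocker_iff_not_tri (by omega) (i + 1) 0 fun f hf => hB f (Finset.mem_of_mem_erase hf),
    not_not] at hne
  rw [isBlocker_iff_not_tri (by omega) i 1 hb.1] at hb
  apply hb
  rw [show i + 1 + (n - 1) = n + i by omega] at hne
  rw [show i + (n + 1 - 1) = n + i by omega]
  refine Tri.glue (Or.inr (Or.inl (by omega))) (Tri.side i)
    (Tri.mono_window (s := i + 1) (t := n + i) ?_ hne le_rfl le_rfl)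
  rintro p q hp hpq hq hA
  have key : s((p : ZMod n), (q : ZMod n)) ∉ B.erase e →
      s(((p + 1 : ℕ) : ZMod (n + 1)), ((q + 1 : ℕ) : ZMod (n + 1))) ∉
        (B.image (insEdge n i) ∪ {newEdge n i x, newEdge n i y}).erase (insEdge n i e) := by
    rw [Finset.mem_erase, Finset.mem_erase, Finset.mem_union, Finset.mem_insert,
      Finset.mem_singleton, mem_image_insEdge hin hp hpq hq]
    have n₁ := newEdge_ne hp hpq hq hx hx'
    have n₂ := newEdge_ne hp hpq hq hy hy'
    rw [← insEdge_natCast hin hp hpq hq] at n₁ n₂ ⊢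
    rw [(insEdge_injective hin).ne_iff]
    tauto
  rcases hA with hA | hA | hA
  · exact Or.inl hA
  · obtain ⟨rfl, rfl⟩ : p = i + 1 ∧ q = n + i := by omega
    exact Or.inr (Or.inr (key fun h => hlong (Finset.mem_of_mem_erase h)))
  · exact Or.inr (Or.inr (key hA))

theorem isSaturatedBlocker_insert_iff (hn : 7 ≤ n) (hB : IsSaturatedBlocker n B)
    (hcard : B.card = n - 2) (h : StdForm n m idx B) (hF : BeamData n m i (beamEnd n m idx))
    {x y : ℕ} (hxy : x ≠ y) (hx : i < x) (hx' : x ≤ n + i) (hy : i < y) (hy' : y ≤ n + i) :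
    (IsSaturatedBlocker (n + 1) (B.image (insEdge n i) ∪ {newEdge n i x, newEdge n i y}) ∧
      (B.image (insEdge n i) ∪ {newEdge n i x, newEdge n i y}).card = n) ↔
    LeftSit n m i (beamEnd n m idx) x y ∨ RightSit n i (beamEnd n m idx) x y := by
  have hin := hF.i_lt
  have hmi := hF.le_i
  have hBe := hB.1.1
  have hne : newEdge n i x ≠ newEdge n i y := by
    rwa [Ne, newEdge_inj hx hx' hy hy']
  have hx_mem := newEdge_notMem_image hin hBe hx hx'
  have hy_mem := newEdge_notMem_image hin hBe hy hy'
  have hc : (B.image (insEdge n i) ∪ {newEdge n i x, newEdge n i y}).card = n := by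
    rw [Finset.card_union_of_disjoint, Finset.card_image_of_injective _ (insEdge_injective hin),
      Finset.card_pair hne, hcard]
    · omega
    · rw [Finset.disjoint_right]
      intro e he
      rcases Finset.mem_insert.1 he with rfl | he
      · exact hx_mem
      · rwa [Finset.mem_singleton.1 he]
  have ex : (B.image (insEdge n i) ∪ {newEdge n i x, newEdge n i y}).erase (newEdge n i x) =
      B.image (insEdge n i) ∪ {newEdge n i y, newEdge n i y} := by
    ext e
    simp only [Finset.mem_erase, Finset.mem_union, Finset.mem_insert, Finset.mem_singleton]
    rcases eq_or_ne e (newEdge n i x) with rfl | he <;> tauto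
  have ey : (B.image (insEdge n i) ∪ {newEdge n i x, newEdge n i y}).erase (newEdge n i y) =
      B.image (insEdge n i) ∪ {newEdge n i x, newEdge n i x} := by
    ext e
    simp only [Finset.mem_erase, Finset.mem_union, Finset.mem_insert, Finset.mem_singleton]
    rcases eq_or_ne e (newEdge n i y) with rfl | he <;> tauto
  have hlong : s(((i + 1 : ℕ) : ZMod n), ((n + i : ℕ) : ZMod n)) ∉ B := by
    rw [h.mem_iff_bad hF (by omega) (by omega) le_rfl]
    have h₁ := hF.le (i + 1) (by omega) (by omega)
    have h₂ := hF.pos i (by omega) (by omega)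
    unfold Bad
    rw [Nat.add_sub_cancel_left]
    omega
  rw [and_iff_left hc, ← free_iff_sit hF hxy hx hx' hy hy',
    ← isBlocker_insert_iff_not_free hn hBe h hF hx hx' hy hy']
  have bx := isBlocker_insert_iff_not_free hn hBe h hF hx hx' hx hx'
  have bY := isBlocker_insert_iff_not_free hn hBe h hF hy hy' hy hy'
  rw [← ey] at bx
  rw [← ex] at bY
  constructor
  · rintro ⟨h₁, h₂⟩
    refine ⟨h₁, not_not.1 ((not_congr bx).1 (h₂ _ ?_)), not_not.1 ((not_congr bY).1 (h₂ _ ?_))⟩ <;>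
      simp
  · rintro ⟨h₁, h₂, h₃⟩
    refine ⟨h₁, fun e he => ?_⟩
    simp only [Finset.mem_union, Finset.mem_image, Finset.mem_insert, Finset.mem_singleton] at he
    rcases he with ⟨e, he, rfl⟩ | rfl | rfl
    · exact not_isBlocker_erase_insEdge hn hin hBe (hB.2 e he) hx hx' hy hy' hlong
    · exact fun hb => (bY.1 hb) h₃
    · exact fun hb => (bx.1 hb) h₂

theorem isBeamEdge_iff (hF : BeamData n m i (beamEnd n m idx)) {j : ℕ} (hj : m + 2 ≤ j)
    (hj' : j < n) (z : ZMod n) :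
    IsBeamEdge n m idx s((j : ZMod n), z) ↔ m + 2 < j ∧ z = (beamEnd n m idx j : ZMod n) := by
  unfold IsBeamEdge
  have inj : ∀ a b : ℕ, a < n → b < n → ((a : ZMod n) = (b : ZMod n) ↔ a = b) := fun a b ha hb =>
    cast_inj_of_window (s := 0) (d := 0) (by omega) (by omega) (by omega) (by omega) (by omega)
  constructor
  · rintro ⟨k, hk, he⟩
    rw [Finset.mem_Icc] at hk
    rw [← beamEnd_add (n := n) (m := m) (idx := idx) (j := k) (by omega) (by omega), Sym2.eq_iff] at he
    have := hF.le (m + 2 + k) (by omega) (by omega)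
    rcases he with ⟨h₁, h₂⟩ | ⟨h₁, -⟩
    · rw [inj _ _ (by omega) (by omega)] at h₁
      exact ⟨by omega, by rw [h₂, h₁]⟩
    · rw [inj _ _ (by omega) (by omega)] at h₁
      omega
  · rintro ⟨h, rfl⟩
    obtain ⟨k, rfl⟩ := Nat.exists_eq_add_of_le hj
    exact ⟨k, Finset.mem_Icc.2 (by omega), by rw [beamEnd_add (by omega) (by omega)]⟩

theorem IsBeamEdge.exists_outer {e : Sym2 (ZMod n)} (he : IsBeamEdge n m idx e) :
    ∃ j, m + 2 < j ∧ j < n ∧ e = s((j : ZMod n), (beamEnd n m idx j : ZMod n)) := by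
  obtain ⟨k, hk, rfl⟩ := he
  rw [Finset.mem_Icc] at hk
  exact ⟨m + 2 + k, by omega, by omega, by rw [beamEnd_add (by omega) (by omega)]⟩

theorem newEdge_pair_eq_iff {x y x' y' : ℕ} (hxy : x ≠ y) (hx : i < x) (hx₁ : x ≤ n + i)
    (hy : i < y) (hy₁ : y ≤ n + i) (hx' : i < x') (hx₁' : x' ≤ n + i) (hy' : i < y')
    (hy₁' : y' ≤ n + i) :
    ({newEdge n i x, newEdge n i y} : Finset (Sym2 (ZMod (n + 1)))) =
      {newEdge n i x', newEdge n i y'} ↔ (x = x' ∧ y = y') ∨ (y = x' ∧ x = y') := by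
  constructor
  · intro h
    have h₁ : newEdge n i x ∈ ({newEdge n i x', newEdge n i y'} : Finset _) := by simp [← h]
    have h₂ : newEdge n i y ∈ ({newEdge n i x', newEdge n i y'} : Finset _) := by simp [← h]
    rw [Finset.mem_insert, Finset.mem_singleton, newEdge_inj hx hx₁ hx' hx₁',
      newEdge_inj hx hx₁ hy' hy₁'] at h₁
    rw [Finset.mem_insert, Finset.mem_singleton, newEdge_inj hy hy₁ hx' hx₁',
      newEdge_inj hy hy₁ hy' hy₁'] at h₂
    omega
  · rintro (⟨rfl, rfl⟩ | ⟨rfl, rfl⟩)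
    · rfl
    · exact Finset.pair_comm _ _

end

end ConvexBlocker

open ConvexBlocker in
/-- inserting a vertex `v` between `i` and `i+1` (with `m+2 ≤ i ≤ n-1`) outside
the boundary net of a standard-form saturated blocker `B` of size `n-2`, and adding two edges
`e₁, e₂` at `v`, yields a saturated blocker of size `n` of the `(n+1)`-gon iff one of the two
listed beam configurations holds. -/
theorem insert_vertex_outside_boundary_net
    (n : ℕ) (hn : 7 ≤ n) (m : ℕ) (idx : ℕ → ℕ) (B : Finset (Sym2 (ZMod n)))
    (hB : IsSaturatedBlocker n B) (hcard : B.card = n - 2)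
    (hstd : StdForm n m idx B)
    (i : ℕ) (hi1 : m + 2 ≤ i) (hi2 : i ≤ n - 1)
    (e₁ e₂ : Sym2 (ZMod (n + 1))) (hne : e₁ ≠ e₂)
    (he₁ : IsEdge (n + 1) e₁) (he₂ : IsEdge (n + 1) e₂)
    (hv₁ : ((i + 1 : ℕ) : ZMod (n + 1)) ∈ e₁) (hv₂ : ((i + 1 : ℕ) : ZMod (n + 1)) ∈ e₂) :
    (IsSaturatedBlocker (n + 1) (B.image (insEdge n i) ∪ {e₁, e₂}) ∧
        (B.image (insEdge n i) ∪ {e₁, e₂}).card = n) ↔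
    ((∃ k l : ℕ, m + 2 < k ∧ k < i ∧
        IsBeamEdge n m idx (s((i : ZMod n), (l : ZMod n))) ∧
        IsBeamEdge n m idx (s((k : ZMod n), ((l - 1 : ℕ) : ZMod n))) ∧
        Cross n (s((k : ZMod n), ((l - 1 : ℕ) : ZMod n))) (s((i : ZMod n), (l : ZMod n))) ∧
        (∀ e : Sym2 (ZMod n), IsBeamEdge n m idx e →
          Cross n e (s((i : ZMod n), (l : ZMod n))) →
          e = s((k : ZMod n), ((l - 1 : ℕ) : ZMod n))) ∧
        ({e₁, e₂} : Finset (Sym2 (ZMod (n + 1)))) =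
          {s(((i + 1 : ℕ) : ZMod (n + 1)), insVx n i (k : ZMod n)),
           s(((i + 1 : ℕ) : ZMod (n + 1)), insVx n i ((l + 1 : ℕ) : ZMod n))}) ∨
     (∃ k l : ℕ, i + 1 < k ∧ k ≤ n - 1 ∧
        IsBeamEdge n m idx (s(((i + 1 : ℕ) : ZMod n), (l : ZMod n))) ∧
        IsBeamEdge n m idx (s((k : ZMod n), ((l + 1 : ℕ) : ZMod n))) ∧
        Cross n (s((k : ZMod n), ((l + 1 : ℕ) : ZMod n)))
          (s(((i + 1 : ℕ) : ZMod n), (l : ZMod n))) ∧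
        (∀ e : Sym2 (ZMod n), IsBeamEdge n m idx e →
          Cross n e (s(((i + 1 : ℕ) : ZMod n), (l : ZMod n))) →
          e = s((k : ZMod n), ((l + 1 : ℕ) : ZMod n))) ∧
        ({e₁, e₂} : Finset (Sym2 (ZMod (n + 1)))) =
          {s(((i + 1 : ℕ) : ZMod (n + 1)), insVx n i (k : ZMod n)),
           s(((i + 1 : ℕ) : ZMod (n + 1)), insVx n i ((l - 1 : ℕ) : ZMod n))})) := by
  have hF := hstd.beamData hn hi1 hi2
  have hin := hF.i_lt
  have hle := hF.le
  have hpos := hF.pos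
  obtain ⟨x, hx, hx', rfl⟩ := he₁.exists_newEdge hv₁
  obtain ⟨y, hy, hy', rfl⟩ := he₂.exists_newEdge hv₂
  have hxy : x ≠ y := by
    rintro rfl
    exact hne rfl
  rw [isSaturatedBlocker_insert_iff hn hB hcard hstd hF hxy hx hx' hy hy']
  have cast_inj : ∀ a b : ℕ, a < n → b < n → (a : ZMod n) = (b : ZMod n) → a = b :=
    fun a b ha hb => (cast_inj_of_window (s := 0) (d := 0) (by omega) (by omega) (by omega)
      (by omega) (by omega)).1
  have cast_pred : ∀ l F : ℕ, 1 ≤ F → F < n → (l : ZMod n) = (F : ZMod n) →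
      ((l - 1 : ℕ) : ZMod n) = ((F - 1 : ℕ) : ZMod n) := by
    intro l F h₁ h₂ h
    have hl : 1 ≤ l := by
      by_contra hl
      have := cast_inj l F (by omega) h₂ h
      omega
    rw [Nat.cast_sub hl, Nat.cast_sub h₁, h]
  have new : ∀ a b : ℕ, (a : ZMod n) = (b : ZMod n) → i < b → b ≤ n + i →
      s(((i + 1 : ℕ) : ZMod (n + 1)), insVx n i (a : ZMod n)) = newEdge n i b := by
    intro a b hab h₁ h₂
    rw [hab, insVx_natCast hin h₁ h₂]
    rfl
  refine or_congr (exists_congr fun k => ?_) (exists_congr fun k => ?_)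
  · constructor
    · rintro ⟨hk₁, hk₂, hk₃, hu, hs⟩
      have hi := hle i (by omega) (by omega)
      have hk := hpos k (by omega) (by omega)
      have e : beamEnd n m idx k = beamEnd n m idx i - 1 := by omega
      refine ⟨beamEnd n m idx i, hk₁, hk₂, (isBeamEdge_iff hF hi1 hin _).2 ⟨by omega, rfl⟩, ?_⟩
      rw [← e]
      refine ⟨(isBeamEdge_iff hF (by omega) (by omega) _).2 ⟨by omega, rfl⟩, ?_, ?_, ?_⟩
      · rw [cross_beams (by omega) (by omega) (by omega) (by omega)]
        exact Or.inl (by omega)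
      · intro f hf hfc
        obtain ⟨j, hj₁, hj₂, rfl⟩ := hf.exists_outer
        have := hle j (by omega) (by omega)
        rw [cross_beams (by omega) (by omega) (by omega) (by omega)] at hfc
        rcases hfc with hfc | hfc
        · rw [hu j hj₁ (by omega) hfc.1]
        · have := hF.jump k j (by omega) (by omega) (by omega)
          omega
      · rw [new k (n + k) (natCast_add_left_self n k).symm (by omega) (by omega),
          new _ (n + beamEnd n m idx i + 1) (by rw [add_assoc, natCast_add_left_self]) (by omega)
            (by omega),
          newEdge_pair_eq_iff hxy hx hx' hy hy' (by omega) (by omega) (by omega) (by omega)]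
        exact hs
    · rintro ⟨l, hk₁, hk₂, hb₁, hb₂, -, hu, hs⟩
      have hi := hle i (by omega) (by omega)
      have hi' := hpos i (by omega) (by omega)
      have hk := hle k (by omega) (by omega)
      obtain ⟨-, hl⟩ := (isBeamEdge_iff hF hi1 hin _).1 hb₁
      obtain ⟨-, hl'⟩ := (isBeamEdge_iff hF (by omega) (by omega) _).1 hb₂
      have e := cast_inj _ _ (by omega) (by omega) ((cast_pred l _ hi' (by omega) hl).symm.trans hl')
      have hk' := hpos k (by omega) (by omega)
      refine ⟨hk₁, hk₂, by omega, ?_, ?_⟩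
      · intro k' hk₁' hk₂' hlt
        have := hu _ ((isBeamEdge_iff hF (j := k') (by omega) (by omega) _).2 ⟨hk₁', rfl⟩) (by
          rw [hl, cross_beams (by omega) (by omega) (by omega) (by omega)]
          exact Or.inl (by omega))
        rw [hl', Sym2.eq_iff] at this
        rcases this with ⟨h, -⟩ | ⟨h, -⟩
        · exact cast_inj _ _ (by omega) (by omega) h
        · have := cast_inj _ _ (by omega) (by omega) h
          omega
      · rwa [new k (n + k) (natCast_add_left_self n k).symm (by omega) (by omega),
          new _ (n + beamEnd n m idx i + 1)
            (by rw [add_assoc, natCast_add_left_self, Nat.cast_add, hl, Nat.cast_add]) (by omega)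
            (by omega),
          newEdge_pair_eq_iff hxy hx hx' hy hy' (by omega) (by omega) (by omega) (by omega)] at hs
  · constructor
    · rintro ⟨hk₁, hk₂, hk₃, hu, hs⟩
      have hi := hle (i + 1) (by omega) (by omega)
      have hi' := hpos (i + 1) (by omega) (by omega)
      have hk := hle k (by omega) (by omega)
      refine ⟨beamEnd n m idx (i + 1), hk₁, by omega,
        (isBeamEdge_iff hF (by omega) (by omega) _).2 ⟨by omega, rfl⟩, ?_⟩
      rw [← hk₃]
      refine ⟨(isBeamEdge_iff hF (by omega) (by omega) _).2 ⟨by omega, rfl⟩, ?_, ?_, ?_⟩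
      · rw [cross_beams (by omega) (by omega) (by omega) (by omega)]
        exact Or.inr (by omega)
      · intro f hf hfc
        obtain ⟨j, hj₁, hj₂, rfl⟩ := hf.exists_outer
        have := hle j (by omega) (by omega)
        rw [cross_beams (by omega) (by omega) (by omega) (by omega)] at hfc
        rcases hfc with hfc | hfc
        · have := hF.jump j k (by omega) (by omega) (by omega)
          omega
        · rw [hu j (by omega) hj₂ hfc.1]
      · rw [new k k rfl (by omega) (by omega),
          new _ (n + (beamEnd n m idx (i + 1) - 1)) (natCast_add_left_self n _).symm (by omega)
            (by omega),
          newEdge_pair_eq_iff hxy hx hx' hy hy' (by omega) (by omega) (by omega) (by omega)]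
        omega
    · rintro ⟨l, hk₁, hk₂, hb₁, hb₂, -, hu, hs⟩
      have hi := hle (i + 1) (by omega) (by omega)
      have hi' := hpos (i + 1) (by omega) (by omega)
      have hk := hle k (by omega) (by omega)
      obtain ⟨-, hl⟩ := (isBeamEdge_iff hF (by omega) (by omega) _).1 hb₁
      obtain ⟨-, hl'⟩ := (isBeamEdge_iff hF (by omega) (by omega) _).1 hb₂
      have e : beamEnd n m idx (i + 1) + 1 = beamEnd n m idx k :=
        cast_inj _ _ (by omega) (by omega) (by rw [← hl', Nat.cast_add, ← hl, Nat.cast_add])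
      refine ⟨hk₁, by omega, by omega, ?_, ?_⟩
      · intro k' hk₁' hk₂' hlt
        have := hle k' (by omega) (by omega)
        have := hu _ ((isBeamEdge_iff hF (j := k') (by omega) (by omega) _).2 ⟨by omega, rfl⟩) (by
          rw [hl, cross_beams (by omega) (by omega) (by omega) (by omega)]
          exact Or.inr (by omega))
        rw [hl', Sym2.eq_iff] at this
        rcases this with ⟨h, -⟩ | ⟨h, -⟩
        · exact cast_inj _ _ (by omega) (by omega) h
        · have := cast_inj _ _ (by omega) (by omega) h
          omega
      · rw [new k k rfl (by omega) (by omega),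
          new _ (n + (beamEnd n m idx (i + 1) - 1))
            ((cast_pred l _ hi' (by omega) hl).trans (natCast_add_left_self n _).symm) (by omega)
            (by omega),
          newEdge_pair_eq_iff hxy hx hx' hy hy' (by omega) (by omega) (by omega) (by omega)] at hs
        omega
end

section
/- Let n ≥ 7 and let B be a saturated blocker of size n−2 of the convex n-gon in standard form with parameters m and i_1,…,i_{n−3−m}. (a) Insert a new vertex v between the vertices 0 and 1, and let e₁, e₂ be two distinct edges of the resulting (n+1)-gon incident to v. Then B ∪ {e₁, e₂} is a saturated blocker of size n of the (n+1)-gon if and only if deg_B(1) = 2 and {e₁,e₂} = {{v,3},{v,k}}, where k is the vertex with k > m+2 and {k,1} ∈ B. (b) Insert a new vertex v between the vertices m+1 and m+2, and let e₁, e₂ be two distinct edges of the resulting (n+1)-gon incident to v. Then B ∪ {e₁, e₂} is a saturated blocker of size n of the (n+1)-gon if and only if deg_B(m+1) = 2 and {e₁,e₂} = {{v,m−1},{v,k}}, where k is the vertex with k > m+2 and {k,m+1} ∈ B. -/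
open Finset

namespace ConvexBlocker

/-- The pairs `a < b` and `c < d` interleave. -/
def Interleave (a b c d : ℕ) : Prop :=
  (a < c ∧ c < b ∧ b < d) ∨ (c < a ∧ a < d ∧ d < b)

/-- The pair `a < b` spans a diagonal of the polygon with vertices `0, …, N - 1`. -/
def SpansDiagonal (N a b : ℕ) : Prop :=
  a + 2 ≤ b ∧ ¬ (a = 0 ∧ b + 1 = N)

/-- Some pairwise non-interleaving family of pairs interleaves with every diagonal in `C`.
This is the negation of `C` being a blocker, see `IsLabelling.isBlocker_iff_not_pierced`. -/
def Pierced (N : ℕ) (C : ℕ → ℕ → Prop) : Prop :=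
  ∃ X : ℕ → ℕ → Prop, (∀ a b, X a b → a < b ∧ b < N) ∧
    (∀ a b c d, X a b → X c d → ¬ Interleave a b c d) ∧
    ∀ a b, a < b → b < N → SpansDiagonal N a b → C a b → ∃ c d, X c d ∧ Interleave a b c d

theorem Pierced.mono {N : ℕ} {C D : ℕ → ℕ → Prop} (h : Pierced N C)
    (hDC : ∀ a b, a < b → b < N → SpansDiagonal N a b → D a b → C a b) : Pierced N D := by
  obtain ⟨X, hX, hnc, hcr⟩ := h
  exact ⟨X, hX, hnc, fun a b hab hb hd hD => hcr a b hab hb hd (hDC a b hab hb hd hD)⟩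

/-- The pairs of `C` after a new vertex, labelled `1`, is inserted right after the vertex `0`. -/
def Inserted (C : ℕ → ℕ → Prop) (a b : ℕ) : Prop :=
  a ≠ 1 ∧ b ≠ 1 ∧ C (a - 1) (b - 1)

section Insertion

variable {n : ℕ} {C : ℕ → ℕ → Prop}

/-- Contracting the new vertex into the vertex after it. -/
theorem Pierced.contract_next (hn : 2 ≤ n)
    (h : Pierced (n + 1) fun a b => Inserted C a b ∨ (a = 1 ∧ C 1 (b - 1))) : Pierced n C := by
  obtain ⟨X, hX, hnc, hcr⟩ := h
  refine ⟨fun c d => c < d ∧ ∃ c₁ d₁, X c₁ d₁ ∧ c = (if c₁ ≤ 1 then c₁ else c₁ - 1) ∧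
    d = (if d₁ ≤ 1 then d₁ else d₁ - 1), ?_, ?_, ?_⟩
  · rintro a b ⟨hab, a₁, b₁, hx, rfl, rfl⟩
    have := hX _ _ hx
    refine ⟨hab, ?_⟩
    split_ifs <;> omega
  · rintro _ _ _ _ ⟨-, a, b, hab, rfl, rfl⟩ ⟨-, c, d, hcd, rfl, rfl⟩ h
    refine hnc _ _ _ _ hab hcd ?_
    have := hX _ _ hab
    have := hX _ _ hcd
    unfold Interleave at h ⊢
    split_ifs at h <;> omega
  · intro a b hab hb hd hCab
    have key : ∀ c d, X c d → Interleave a b (if c ≤ 1 then c else c - 1)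
        (if d ≤ 1 then d else d - 1) → ∃ c d, (c < d ∧ ∃ c₁ d₁, X c₁ d₁ ∧
          c = (if c₁ ≤ 1 then c₁ else c₁ - 1) ∧ d = (if d₁ ≤ 1 then d₁ else d₁ - 1)) ∧
          Interleave a b c d := by
      intro c d hx hI
      refine ⟨_, _, ⟨?_, c, d, hx, rfl, rfl⟩, hI⟩
      unfold Interleave at hI
      omega
    have hdg := hd
    unfold SpansDiagonal at hdg
    obtain ⟨c, d, hx, hI⟩ := hcr (if a = 0 then 0 else a + 1) (b + 1) (by split_ifs <;> omega)
      (by omega)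
      (by by_cases h : a = 0 <;> simp only [SpansDiagonal, h, if_true, if_false] <;> omega)
      (Or.inl ⟨by split_ifs <;> omega, by omega, by
        have : (if a = 0 then 0 else a + 1) - 1 = a := by split_ifs <;> omega
        simpa [this] using hCab⟩)
    have hcd := hX _ _ hx
    by_cases ha : a = 1
    · subst ha
      obtain ⟨c₁, d₁, hx', hI'⟩ := hcr 1 (b + 1) (by omega)
        (by omega) (by unfold SpansDiagonal; omega) (Or.inr ⟨rfl, by simpa using hCab⟩)
      have hcd' := hX _ _ hx'
      have hno := hnc _ _ _ _ hx hx'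
      by_cases hc : c = 1
      · refine key c₁ d₁ hx' ?_
        unfold Interleave at *
        split_ifs at * <;> omega
      · refine key c d hx ?_
        unfold Interleave at *
        split_ifs at * <;> omega
    · refine key c d hx ?_
      unfold Interleave at *
      split_ifs at * <;> omega

/-- Contracting the new vertex into the vertex before it. -/
theorem Pierced.contract_prev
    (h0 : ∀ b, b < n → C 0 b → b = 2)
    (h : Pierced (n + 1) fun a b => Inserted C a b ∨ (a = 1 ∧ b = 3)) : Pierced n C := by
  obtain ⟨X, hX, hnc, hcr⟩ := h
  refine ⟨fun c d => c < d ∧ ∃ c₁ d₁, X c₁ d₁ ∧ c = c₁ - 1 ∧ d = d₁ - 1, ?_, ?_, ?_⟩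
  · rintro a b ⟨hab, a₁, b₁, hx, rfl, rfl⟩
    have := hX _ _ hx
    omega
  · rintro _ _ _ _ ⟨-, a, b, hab, rfl, rfl⟩ ⟨-, c, d, hcd, rfl, rfl⟩ h
    refine hnc _ _ _ _ hab hcd ?_
    unfold Interleave at h ⊢
    omega
  · intro a b hab hb hd hCab
    have key : ∀ c d, X c d → Interleave a b (c - 1) (d - 1) → ∃ c d, (c < d ∧ ∃ c₁ d₁, X c₁ d₁ ∧
          c = c₁ - 1 ∧ d = d₁ - 1) ∧ Interleave a b c d := by
      intro c d hx hI
      refine ⟨_, _, ⟨?_, c, d, hx, rfl, rfl⟩, hI⟩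
      unfold Interleave at hI
      omega
    have hdg := hd
    unfold SpansDiagonal at hdg
    obtain ⟨c, d, hx, hI⟩ := hcr (if a = 0 then 0 else a + 1) (b + 1) (by split_ifs <;> omega)
      (by omega)
      (by by_cases h : a = 0 <;> simp only [SpansDiagonal, h, if_true, if_false] <;> omega)
      (Or.inl ⟨by split_ifs <;> omega, by omega, by
        have : (if a = 0 then 0 else a + 1) - 1 = a := by split_ifs <;> omega
        simpa [this] using hCab⟩)
    have hcd := hX _ _ hx
    by_cases ha : a = 0
    · subst ha
      obtain rfl := h0 b hb hCab
      obtain ⟨c₁, d₁, hx', hI'⟩ := hcr 1 3 (by omega)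
        (by omega) (by unfold SpansDiagonal; omega) (Or.inr ⟨rfl, rfl⟩)
      have hcd' := hX _ _ hx'
      have hno := hnc _ _ _ _ hx hx'
      by_cases hc : c = 1
      · refine key c₁ d₁ hx' ?_
        unfold Interleave at *
        split_ifs at * <;> omega
      · refine key c d hx ?_
        unfold Interleave at *
        split_ifs at * <;> omega
    · refine key c d hx ?_
      unfold Interleave at *
      split_ifs at *
      omega

/-- Cutting off the new vertex pierces all pairs at the new vertex. -/
theorem Pierced.insert_of_cut (h : Pierced n C)
    (hC : ∀ a b, a < b → b < n → C a b → SpansDiagonal n a b) :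
    Pierced (n + 1) fun a b => Inserted C a b ∨ a = 1 := by
  obtain ⟨X, hX, hnc, hcr⟩ := h
  refine ⟨fun c d => (c = 0 ∧ d = 2 ∧ 2 ≤ n) ∨ (c ≠ 1 ∧ d ≠ 1 ∧ c < d ∧ X (c - 1) (d - 1)),
    ?_, ?_, ?_⟩
  · rintro a b (h | ⟨h1, h2, h3, h4⟩)
    · omega
    · have := hX _ _ h4
      omega
  · rintro a b c d (⟨rfl, rfl, -⟩ | ⟨h1, h2, h3, h4⟩) (⟨rfl, rfl, -⟩ | ⟨h5, h6, h7, h8⟩) hI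
    · unfold Interleave at hI; omega
    · unfold Interleave at hI; omega
    · unfold Interleave at hI; omega
    · refine hnc _ _ _ _ h4 h8 ?_
      unfold Interleave at hI ⊢; omega
  · rintro a b hab hb hd (⟨ha, hb', hCab⟩ | rfl)
    · obtain ⟨c, d, hx, hI⟩ := hcr (a - 1) (b - 1)
        (by unfold SpansDiagonal at hd; omega) (by omega)
        (hC _ _ (by unfold SpansDiagonal at hd; omega) (by omega) hCab) hCab
      refine ⟨if c = 0 then 0 else c + 1, d + 1, Or.inr ⟨by split_ifs <;> omega, ?_, ?_, ?_⟩, ?_⟩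
      · have := hX _ _ hx; omega
      · have := hX _ _ hx; split_ifs <;> omega
      · have : (if c = 0 then 0 else c + 1) - 1 = c := by split_ifs <;> omega
        simpa [this] using hx
      · unfold Interleave at *
        split_ifs <;> omega
    · refine ⟨0, 2, Or.inl ⟨rfl, rfl, ?_⟩, ?_⟩
      · omega
      · unfold SpansDiagonal at hd; unfold Interleave; omega

/-- Moving the star of the vertex after the new vertex to the new vertex. -/
theorem Pierced.insert_of_split {w : ℕ}
    (hC : ∀ a b, a < b → b < n → C a b → SpansDiagonal n a b)
    (h : Pierced n fun a b => C a b ∧ ¬ (a = 1 ∧ b = w)) :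
    Pierced (n + 1) fun a b => Inserted C a b ∨ (a = 1 ∧ C 1 (b - 1) ∧ b ≠ w + 1) := by
  obtain ⟨X, hX, hnc, hcr⟩ := h
  have key : ∀ a b, a < b → b < n → C a b → ¬ (a = 1 ∧ b = w) →
      ∃ c d, X c d ∧ Interleave a b c d :=
    fun a b hab hb hCab hw => hcr a b hab hb (hC a b hab hb hCab) ⟨hCab, hw⟩
  refine ⟨fun c d => (c = 1 ∧ d = 3 ∧ 3 ≤ n) ∨ (c ≠ 2 ∧ d ≠ 2 ∧ c < d ∧
    X (if c ≤ 1 then c else c - 1) (if d ≤ 1 then d else d - 1)), ?_, ?_, ?_⟩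
  · rintro a b (h | ⟨h1, h2, h3, h4⟩)
    · omega
    · have := hX _ _ h4
      split_ifs at this <;> omega
  · rintro a b c d (⟨rfl, rfl, -⟩ | ⟨h1, h2, h3, h4⟩) (⟨rfl, rfl, -⟩ | ⟨h5, h6, h7, h8⟩) hI
    · unfold Interleave at hI; omega
    · unfold Interleave at hI; omega
    · unfold Interleave at hI; omega
    · refine hnc _ _ _ _ h4 h8 ?_
      unfold Interleave at hI ⊢; split_ifs <;> omega
  · intro a b hab hb hd h
    have lift : ∀ c d, X c d → Interleave a b (if c ≤ 1 then c else c + 1)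
        (if d ≤ 1 then d else d + 1) → ∃ c d, ((c = 1 ∧ d = 3 ∧ 3 ≤ n) ∨ (c ≠ 2 ∧ d ≠ 2 ∧ c < d ∧
          X (if c ≤ 1 then c else c - 1) (if d ≤ 1 then d else d - 1))) ∧ Interleave a b c d := by
      intro c d hx hI
      have := hX _ _ hx
      refine ⟨_, _, Or.inr ⟨?_, ?_, ?_, ?_⟩, hI⟩
      · split_ifs <;> omega
      · split_ifs <;> omega
      · split_ifs <;> omega
      · convert hx using 1 <;> split_ifs <;> omega
    rcases h with ⟨ha, hb', hCab⟩ | ⟨rfl, hCab, hbw⟩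
    · by_cases haw : a - 1 = 1
      · refine ⟨1, 3, Or.inl ⟨rfl, rfl, by omega⟩, ?_⟩
        unfold SpansDiagonal at hd; unfold Interleave; omega
      · obtain ⟨c, d, hx, hI⟩ := key (a - 1) (b - 1) (by unfold SpansDiagonal at hd; omega)
          (by omega) hCab (by omega)
        refine lift c d hx ?_
        have := hC _ _ (by unfold SpansDiagonal at hd; omega) (by omega) hCab
        unfold SpansDiagonal at *
        unfold Interleave at *
        split_ifs <;> omega
    · obtain ⟨c, d, hx, hI⟩ := key 1 (b - 1) (by unfold SpansDiagonal at hd; omega)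
          (by omega) hCab (by omega)
      refine lift c d hx ?_
      unfold Interleave at *
      split_ifs <;> omega

/-- A fan at the vertex `0`, modified near the new vertex. -/
theorem pierced_insert_fan_zero
    (hC : ∀ a b, a < b → b < n → C a b → SpansDiagonal n a b)
    (h0 : ∀ b, b < n → C 0 b → b = 2) :
    Pierced (n + 1) fun a b => Inserted C a b ∨ (a = 1 ∧ b ≠ 3 ∧ b ≠ 4) := by
  refine ⟨fun c d => d < n + 1 ∧ ((c = 0 ∧ 4 ≤ d) ∨ (c = 1 ∧ (d = 3 ∨ d = 4))), ?_, ?_, ?_⟩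
  · intro a b h; omega
  · intro a b c d h h₁ hI
    unfold Interleave at hI; omega
  · rintro a b hab hb hd (⟨ha, hb', hCab⟩ | h)
    · have hd' := hC _ _ (by unfold SpansDiagonal at hd; omega) (by omega) hCab
      unfold SpansDiagonal at hd hd'
      have h02 : a = 0 → b = 3 := fun h => by
        subst h; have := h0 _ (by omega) hCab; omega
      unfold Interleave
      by_cases h0 : a = 0
      · exact ⟨1, 4, by omega⟩
      by_cases h2 : a = 2
      · exact ⟨1, 3, by omega⟩
      · exact ⟨0, a + 1, by omega⟩
    · unfold SpansDiagonal at hd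
      unfold Interleave
      exact ⟨0, 4, by omega⟩

/-- A fan at a vertex whose only neighbour is the vertex after the new vertex. -/
theorem pierced_insert_fan_leaf {k : ℕ} (hk : 3 < k) (hkn : k < n)
    (hl : ∀ a, a < n → C a k → a = 1) (hr : ∀ b, b < n → ¬ C k b) :
    Pierced (n + 1) fun a b => Inserted C a b ∨ (a = 1 ∧ b ≠ 3 ∧ b ≠ k + 1) := by
  refine ⟨fun c d => d < n + 1 ∧ ((c = 1 ∧ d = 3) ∨ (c ≠ 2 ∧ c < d ∧ d = k + 1) ∨
    (c = k + 1 ∧ c < d)), ?_, ?_, ?_⟩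
  · intro a b h; omega
  · intro a b c d h h₁ hI
    unfold Interleave at hI; omega
  · intro a b hab hb hd h
    have hbk : b = k + 1 → a = 2 := by
      rintro rfl
      rcases h with ⟨h1, h2, h3⟩ | h
      · have := hl _ (by omega) h3; omega
      · omega
    have hak : a ≠ k + 1 := by
      rintro rfl
      rcases h with ⟨h1, h2, h3⟩ | h
      · exact hr _ (by omega) h3
      · omega
    have hb3 : a = 1 → b ≠ 3 := by
      rintro rfl
      rcases h with ⟨h1, h2, h3⟩ | h <;> omega
    have hb1 : b ≠ 1 := by
      unfold SpansDiagonal at hd; omega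
    unfold SpansDiagonal at hd
    unfold Interleave
    by_cases h1 : b = k + 1
    · exact ⟨1, 3, by omega⟩
    by_cases h2 : a < k + 1 ∧ k + 1 < b
    · by_cases h3 : a = 0
      · exact ⟨k + 1, b + 1, by omega⟩
      · exact ⟨0, k + 1, by omega⟩
    by_cases h3 : k + 1 < a
    · exact ⟨k + 1, a + 1, by omega⟩
    · by_cases h4 : a = 1
      · exact ⟨3, k + 1, by omega⟩
      · exact ⟨a + 1, k + 1, by omega⟩

end Insertion


/-- `p` labels the vertices of the `N`-gon by `0, …, N - 1` in cyclic order, in one of the two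
orientations. -/
structure IsLabelling (N : ℕ) (p : ℕ → ZMod N) : Prop where
  injective : ∀ a b, a < N → b < N → p a = p b → a = b
  surjective : ∀ z, ∃ a, a < N ∧ p a = z
  cross_iff : ∀ a b c d, a < b → b < N → c < d → d < N →
    (Cross N s(p a, p b) s(p c, p d) ↔ Interleave a b c d)
  isDiagonal_iff : ∀ a b, a < b → b < N → (IsDiagonal N s(p a, p b) ↔ SpansDiagonal N a b)

theorem val_natCast_sub {N a b : ℕ} (ha : a < N) (hb : b < N) :
    ((b : ZMod N) - a).val = if a ≤ b then b - a else N + b - a := by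
  split_ifs with h
  · rw [← Nat.cast_sub h, ZMod.val_cast_of_lt (by omega)]
  · have : ((b : ZMod N) - a) = ((N + b - a : ℕ) : ZMod N) := by
      rw [Nat.cast_sub (by omega)]; simp
    rw [this, ZMod.val_cast_of_lt (by omega)]

/-- A bijective labelling is a labelling in cyclic order as soon as the lengths of the oriented
arcs are as expected, for one of the two orientations. -/
theorem isLabelling_of_val {N : ℕ} {p : ℕ → ZMod N}
    (hsurj : ∀ z, ∃ a, a < N ∧ p a = z)
    (hval : (∀ a b, a < N → b < N → (p b - p a).val = if a ≤ b then b - a else N + b - a) ∨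
      (∀ a b, a < N → b < N → (p a - p b).val = if a ≤ b then b - a else N + b - a)) :
    IsLabelling N p := by
  have hinj : ∀ a b, a < N → b < N → p a = p b → a = b := by
    intro a b ha hb h
    rcases hval with hval | hval <;>
    · have h1 := hval a b ha hb
      have h2 := hval b a hb ha
      rw [h, sub_self, ZMod.val_zero] at h1 h2
      split_ifs at h1 h2 <;> omega
  refine ⟨hinj, hsurj, ?_, ?_⟩
  · intro a b c d hab hb hcd hd
    constructor
    · rintro ⟨a₁, b₁, c₁, d₁, he, hf, h1, h2, h3⟩
      rw [Sym2.eq_iff] at he hf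
      unfold Interleave
      rcases he with ⟨rfl, rfl⟩ | ⟨rfl, rfl⟩ <;> rcases hf with ⟨rfl, rfl⟩ | ⟨rfl, rfl⟩ <;>
      rcases hval with hval | hval <;>
      · rw [hval _ _ (by omega) (by omega)] at h1 h2
        rw [hval _ _ (by omega) (by omega), hval _ _ (by omega) (by omega)] at h3
        rw [hval _ _ (by omega) (by omega)] at h2
        split_ifs at h1 h2 h3 <;> omega
    · intro h
      have build : ∀ a b c d, a < c → c < b → b < d → d < N →
          Cross N s(p a, p b) s(p c, p d) ∧ Cross N s(p c, p d) s(p a, p b) := by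
        intro a b c d h1 h2 h3 h4
        rcases hval with hval | hval
        · refine ⟨⟨p a, p b, p c, p d, rfl, rfl, ?_⟩,
            ⟨p c, p d, p b, p a, rfl, Sym2.eq_swap, ?_⟩⟩ <;>
          · simp only [hval _ _ (show a < N by omega) (show b < N by omega),
              hval _ _ (show a < N by omega) (show c < N by omega),
              hval _ _ (show a < N by omega) (show d < N by omega),
              hval _ _ (show c < N by omega) (show a < N by omega),
              hval _ _ (show c < N by omega) (show b < N by omega),
              hval _ _ (show c < N by omega) (show d < N by omega)]
            split_ifs <;> omega
        · refine ⟨⟨p b, p a, p c, p d, Sym2.eq_swap, rfl, ?_⟩,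
            ⟨p c, p d, p a, p b, rfl, rfl, ?_⟩⟩ <;>
          · simp only [hval _ _ (show a < N by omega) (show b < N by omega),
              hval _ _ (show a < N by omega) (show c < N by omega),
              hval _ _ (show c < N by omega) (show b < N by omega),
              hval _ _ (show d < N by omega) (show b < N by omega),
              hval _ _ (show b < N by omega) (show c < N by omega),
              hval _ _ (show d < N by omega) (show c < N by omega)]
            split_ifs <;> omega
      rcases h with ⟨h1, h2, h3⟩ | ⟨h1, h2, h3⟩
      · exact (build a b c d h1 h2 h3 hd).1
      · exact (build c d a b h1 h2 h3 hb).2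
  · intro a b hab hb
    have harc : ∀ x y : ZMod N, (∃ c, Btw N x c y) ↔ 2 ≤ (y - x).val := by
      intro x y
      constructor
      · rintro ⟨c, h1, h2⟩
        omega
      · intro h
        have : NeZero N := ⟨by omega⟩
        have hlt := (y - x).val_lt
        have hone : (x + 1 - x).val = 1 := by
          rw [add_sub_cancel_left, ZMod.val_one'' (by omega)]
        exact ⟨x + 1, by omega, by omega⟩
    have hdiag : IsDiagonal N s(p a, p b) ↔ 2 ≤ (p b - p a).val ∧ 2 ≤ (p a - p b).val := by
      constructor
      · rintro ⟨x, y, he, -, h1, h2⟩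
        rw [harc] at h1 h2
        rcases Sym2.eq_iff.1 he with ⟨rfl, rfl⟩ | ⟨rfl, rfl⟩
        exacts [⟨h1, h2⟩, ⟨h2, h1⟩]
      · rintro ⟨h1, h2⟩
        refine ⟨p a, p b, rfl, fun h => ?_, (harc _ _).2 h1, (harc _ _).2 h2⟩
        exact hab.ne (hinj _ _ (by omega) hb h)
    rw [hdiag]
    unfold SpansDiagonal
    rcases hval with hval | hval <;>
    · rw [hval _ _ (by omega) (by omega), hval _ _ (by omega) (by omega)]
      split_ifs <;> omega

theorem isLabelling_natCast {N : ℕ} (hN : 0 < N) : IsLabelling N (fun a => (a : ZMod N)) := by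
  have : NeZero N := ⟨hN.ne'⟩
  exact isLabelling_of_val (fun z => ⟨z.val, z.val_lt, ZMod.natCast_zmod_val z⟩)
    (Or.inl fun a b ha hb => val_natCast_sub ha hb)

theorem isLabelling_sub_natCast {N : ℕ} (hN : 0 < N) (t : ZMod N) :
    IsLabelling N (fun a => t - (a : ZMod N)) := by
  have : NeZero N := ⟨hN.ne'⟩
  refine isLabelling_of_val (fun z => ⟨(t - z).val, (t - z).val_lt, by simp⟩)
    (Or.inr fun a b ha hb => ?_)
  rw [show t - (a : ZMod N) - (t - b) = b - a by ring]
  exact val_natCast_sub ha hb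

section

variable {N : ℕ} {p : ℕ → ZMod N}

theorem IsLabelling.exists_lt (hp : IsLabelling N p) {x y : ZMod N} (h : x ≠ y) :
    ∃ a b, a < b ∧ b < N ∧ s(x, y) = s(p a, p b) := by
  obtain ⟨a, ha, rfl⟩ := hp.surjective x
  obtain ⟨b, hb, rfl⟩ := hp.surjective y
  have hab : a ≠ b := fun h₁ => h (by rw [h₁])
  rcases lt_or_gt_of_ne hab with h | h
  · exact ⟨a, b, h, hb, rfl⟩
  · exact ⟨b, a, h, ha, Sym2.eq_swap⟩

theorem IsLabelling.mk_eq_iff (hp : IsLabelling N p) {a b c d : ℕ} (ha : a < N) (hb : b < N)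
    (hc : c < N) (hd : d < N) :
    s(p a, p b) = s(p c, p d) ↔ (a = c ∧ b = d) ∨ (a = d ∧ b = c) := by
  rw [Sym2.eq_iff]
  constructor
  · rintro (⟨h1, h2⟩ | ⟨h1, h2⟩)
    · exact Or.inl ⟨hp.injective _ _ ha hc h1, hp.injective _ _ hb hd h2⟩
    · exact Or.inr ⟨hp.injective _ _ ha hd h1, hp.injective _ _ hb hc h2⟩
  · rintro (⟨rfl, rfl⟩ | ⟨rfl, rfl⟩) <;> simp

theorem IsLabelling.exists_isTriangulation_superset [NeZero N] (hp : IsLabelling N p)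
    (T : Finset (Sym2 (ZMod N))) (hd : ∀ e ∈ T, IsDiagonal N e)
    (hnc : ∀ e ∈ T, ∀ f ∈ T, ¬ Cross N e f) :
    ∃ T₁, T ⊆ T₁ ∧ IsTriangulation N T₁ := by
  classical
  obtain ⟨M, hTM, hM⟩ := Finite.exists_le_maximal
    (p := fun T : Finset (Sym2 (ZMod N)) =>
      (∀ e ∈ T, IsDiagonal N e) ∧ ∀ e ∈ T, ∀ f ∈ T, ¬ Cross N e f) (a := T) ⟨hd, hnc⟩
  refine ⟨M, hTM, hM.prop.1, hM.prop.2, fun e he heM => ?_⟩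
  by_contra! hcr
  refine heM (hM.le_of_ge (y := insert e M) ⟨?_, ?_⟩ (Finset.subset_insert e M)
    (Finset.mem_insert_self e M))
  · intro f hf
    rcases Finset.mem_insert.1 hf with rfl | hf
    exacts [he, hM.prop.1 f hf]
  · have rep : ∀ e, IsDiagonal N e → ∃ a b, a < b ∧ b < N ∧ e = s(p a, p b) := by
      rintro _ ⟨x, y, rfl, hxy, -⟩
      exact hp.exists_lt hxy
    intro f hf g hg
    rcases Finset.mem_insert.1 hf with hfe | hfM <;> rcases Finset.mem_insert.1 hg with hge | hgM
    · obtain ⟨a, b, hab, hb, rfl⟩ := rep e he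
      rw [hfe, hge, hp.cross_iff _ _ _ _ hab hb hab hb]
      unfold Interleave
      omega
    · exact hfe ▸ hcr g hgM
    · have := hcr f hfM
      obtain ⟨a, b, hab, hb, rfl⟩ := rep f (hM.prop.1 f hfM)
      obtain ⟨c, d, hcd, hd, rfl⟩ := rep e he
      rw [hp.cross_iff _ _ _ _ hcd hd hab hb] at this
      rw [hge, hp.cross_iff _ _ _ _ hab hb hcd hd]
      unfold Interleave at *
      omega
    · exact hM.prop.2 f hfM g hgM

theorem IsLabelling.isBlocker_iff_not_pierced [NeZero N] (hp : IsLabelling N p)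
    (B : Finset (Sym2 (ZMod N))) :
    IsBlocker N B ↔ (∀ e ∈ B, IsEdge N e) ∧
      ¬ Pierced N (fun a b => s(p a, p b) ∈ B) := by
  classical
  refine and_congr_right fun hB => ⟨?_, ?_⟩
  · rintro hT ⟨X, hX, hnc, hcr⟩
    let T₀ : Finset (Sym2 (ZMod N)) := Finset.univ.filter fun e =>
      IsDiagonal N e ∧ ∃ a b, X a b ∧ e = s(p a, p b)
    obtain ⟨T, hsub, hTr⟩ := hp.exists_isTriangulation_superset T₀
      (fun e he => (Finset.mem_filter.1 he).2.1) (by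
        intro e he f hf
        obtain ⟨-, -, a, b, hab, rfl⟩ := Finset.mem_filter.1 he
        obtain ⟨-, -, c, d, hcd, rfl⟩ := Finset.mem_filter.1 hf
        rw [hp.cross_iff _ _ _ _ (hX _ _ hab).1 (hX _ _ hab).2 (hX _ _ hcd).1 (hX _ _ hcd).2]
        exact hnc _ _ _ _ hab hcd)
    obtain ⟨e, he⟩ := hT T hTr
    obtain ⟨heB, heT⟩ := Finset.mem_inter.1 he
    obtain ⟨x, y, rfl, hxy, -⟩ := hTr.1 e heT
    obtain ⟨a, b, hab, hb, heq⟩ := hp.exists_lt hxy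
    rw [heq] at heB heT
    obtain ⟨c, d, hcd, hI⟩ := hcr a b hab hb
      ((hp.isDiagonal_iff a b hab hb).1 (hTr.1 _ heT)) heB
    obtain ⟨hcd', hd⟩ := hX _ _ hcd
    refine hTr.2.1 _ heT s(p c, p d) (hsub ?_) ((hp.cross_iff _ _ _ _ hab hb hcd' hd).2 hI)
    refine Finset.mem_filter.2 ⟨Finset.mem_univ _, ?_, c, d, hcd, rfl⟩
    rw [hp.isDiagonal_iff _ _ hcd' hd]
    unfold Interleave at hI
    unfold SpansDiagonal
    omega
  · intro hnp T hT
    by_contra hemp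
    rw [Finset.not_nonempty_iff_eq_empty, Finset.eq_empty_iff_forall_notMem] at hemp
    refine hnp ⟨fun a b => a < b ∧ b < N ∧ s(p a, p b) ∈ T, fun a b h => ⟨h.1, h.2.1⟩, ?_, ?_⟩
    · rintro a b c d ⟨hab, hb, h⟩ ⟨hcd, hd, h₁⟩ hI
      exact hT.2.1 _ h _ h₁ ((hp.cross_iff _ _ _ _ hab hb hcd hd).2 hI)
    · intro a b hab hb hdg hmem
      obtain ⟨f, hf, hcr⟩ := hT.2.2 _ ((hp.isDiagonal_iff a b hab hb).2 hdg)
        (fun h => hemp _ (Finset.mem_inter.2 ⟨hmem, h⟩))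
      obtain ⟨x, y, rfl, hxy, -⟩ := hT.1 f hf
      obtain ⟨c, d, hcd, hd, heq⟩ := hp.exists_lt hxy
      rw [heq] at hf hcr
      exact ⟨c, d, ⟨hcd, hd, hf⟩, (hp.cross_iff _ _ _ _ hab hb hcd hd).1 hcr⟩

end


section Main

variable {n i : ℕ} {p : ℕ → ZMod n} {q : ℕ → ZMod (n + 1)} {B : Finset (Sym2 (ZMod n))}

/-- The edges of `B`, as increasing pairs of labels. -/
def labelPairs (p : ℕ → ZMod n) (B : Finset (Sym2 (ZMod n))) (a b : ℕ) : Prop :=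
  a < b ∧ s(p a, p b) ∈ B

theorem mk_mem_image_insEdge_iff (hp : IsLabelling n p) (hq : IsLabelling (n + 1) q)
    (hins : ∀ x, x < n → insVx n i (p x) = q (if x = 0 then 0 else x + 1))
    {a b : ℕ} (hab : a < b) (hb : b < n + 1) :
    s(q a, q b) ∈ B.image (insEdge n i) ↔ Inserted (labelPairs p B) a b := by
  rw [Finset.mem_image]
  constructor
  · rintro ⟨e, he, heq⟩
    induction e using Sym2.ind with
    | _ x y =>
      obtain ⟨x, hx, rfl⟩ := hp.surjective x
      obtain ⟨y, hy, rfl⟩ := hp.surjective y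
      rw [insEdge, Sym2.map_mk, hins x hx, hins y hy,
        hq.mk_eq_iff (by split_ifs <;> omega) (by split_ifs <;> omega) (by omega) hb] at heq
      rcases heq with ⟨h1, h2⟩ | ⟨h1, h2⟩
      · have hxa : x = a - 1 := by split_ifs at h1 <;> omega
        have hyb : y = b - 1 := by split_ifs at h2 <;> omega
        refine ⟨?_, ?_, ?_, hxa ▸ hyb ▸ he⟩
        all_goals split_ifs at h1 h2 <;> omega
      · have hxa : x = b - 1 := by split_ifs at h1 <;> omega
        have hyb : y = a - 1 := by split_ifs at h2 <;> omega
        refine ⟨?_, ?_, ?_, by rw [Sym2.eq_swap]; exact hxa ▸ hyb ▸ he⟩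
        all_goals split_ifs at h1 h2 <;> omega
  · rintro ⟨ha1, hb1, hlt, hmem⟩
    refine ⟨_, hmem, ?_⟩
    rw [insEdge, Sym2.map_mk, hins _ (by omega), hins _ (by omega)]
    congr 2 <;> split_ifs <;> omega

theorem newVertex_notMem (hp : IsLabelling n p) (hq : IsLabelling (n + 1) q) (hn : 0 < n)
    (hins : ∀ x, x < n → insVx n i (p x) = q (if x = 0 then 0 else x + 1))
    {e : Sym2 (ZMod (n + 1))} (he : e ∈ B.image (insEdge n i)) : q 1 ∉ e := by
  obtain ⟨e, -, rfl⟩ := Finset.mem_image.1 he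
  intro h
  obtain ⟨x, -, hx⟩ := Sym2.mem_map.1 h
  obtain ⟨x, hxn, rfl⟩ := hp.surjective x
  rw [hins x hxn] at hx
  have := hq.injective _ _ (by split_ifs <;> omega) (by omega) hx
  split_ifs at this
  omega

theorem isEdge_of_mem_image (hp : IsLabelling n p) (hq : IsLabelling (n + 1) q)
    (hins : ∀ x, x < n → insVx n i (p x) = q (if x = 0 then 0 else x + 1))
    (hB : ∀ e ∈ B, IsEdge n e) {e : Sym2 (ZMod (n + 1))} (he : e ∈ B.image (insEdge n i)) :
    IsEdge (n + 1) e := by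
  obtain ⟨e, heB, rfl⟩ := Finset.mem_image.1 he
  obtain ⟨x, y, rfl, hxy⟩ := hB e heB
  obtain ⟨x, hx, rfl⟩ := hp.surjective x
  obtain ⟨y, hy, rfl⟩ := hp.surjective y
  refine ⟨_, _, Sym2.map_mk .., fun h => hxy ?_⟩
  rw [hins x hx, hins y hy] at h
  have := hq.injective _ _ (by split_ifs <;> omega) (by split_ifs <;> omega) h
  rw [show x = y by split_ifs at this <;> omega]

theorem insEdge_injective_s14 (hp : IsLabelling n p) (hq : IsLabelling (n + 1) q)
    (hins : ∀ x, x < n → insVx n i (p x) = q (if x = 0 then 0 else x + 1)) :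
    Function.Injective (insEdge n i) := by
  refine Sym2.map.injective fun x y h => ?_
  obtain ⟨x, hx, rfl⟩ := hp.surjective x
  obtain ⟨y, hy, rfl⟩ := hp.surjective y
  rw [hins x hx, hins y hy] at h
  have := hq.injective _ _ (by split_ifs <;> omega) (by split_ifs <;> omega) h
  rw [show x = y by split_ifs at this <;> omega]

/-- The characterization of the two-edge extensions, in labels for which the new vertex is
inserted right after the vertex `0`. -/
theorem isSaturatedBlocker_insert_iff_s14 (hn : 7 ≤ n) (hp : IsLabelling n p)
    (hq : IsLabelling (n + 1) q)
    (hins : ∀ x, x < n → insVx n i (p x) = q (if x = 0 then 0 else x + 1))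
    (hB : IsSaturatedBlocker n B) (hcard : B.card = n - 2)
    (hdiag : ∀ a b, a < b → b < n → s(p a, p b) ∈ B → SpansDiagonal n a b)
    (hzero : ∀ b, 0 < b → b < n → s(p 0, p b) ∈ B → b = 2)
    (hthree : s(p 1, p 3) ∈ B)
    (hleaf : ∀ k, k < n → k ≠ 3 → s(p k, p 1) ∈ B → ∀ a, a < n → s(p a, p k) ∈ B → a = 1)
    {e₁ e₂ : Sym2 (ZMod (n + 1))} (hne : e₁ ≠ e₂)
    (he₁ : IsEdge (n + 1) e₁) (he₂ : IsEdge (n + 1) e₂) (hv₁ : q 1 ∈ e₁) (hv₂ : q 1 ∈ e₂) :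
    (IsSaturatedBlocker (n + 1) (B.image (insEdge n i) ∪ {e₁, e₂}) ∧
        (B.image (insEdge n i) ∪ {e₁, e₂}).card = n) ↔
      (degB n B (p 1) = 2 ∧ ∃ k, 3 < k ∧ k < n ∧ s(p k, p 1) ∈ B ∧
        ({e₁, e₂} : Finset (Sym2 (ZMod (n + 1)))) = {s(q 1, q 4), s(q 1, q (k + 1))}) := by
  have : NeZero n := ⟨by omega⟩
  set C := labelPairs p B
  have hC : ∀ a b, a < b → b < n → C a b → SpansDiagonal n a b :=
    fun a b hab hb h => hdiag a b hab hb h.2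
  have hC0 : ∀ b, b < n → C 0 b → b = 2 := fun b hb h => hzero b h.1 hb h.2
  have hCB : ¬ Pierced n C := fun h =>
    ((hp.isBlocker_iff_not_pierced B).1 hB.1).2 (h.mono fun a b hab _ _ hm => ⟨hab, hm⟩)
  have hedge : ∀ e ∈ B.image (insEdge n i), IsEdge (n + 1) e :=
    fun e he => isEdge_of_mem_image hp hq hins hB.1.1 he
  have hnew : ∀ e ∈ B.image (insEdge n i), q 1 ∉ e :=
    fun e he => newVertex_notMem hp hq (by omega) hins he
  have hmem : ∀ a b, a < b → b < n + 1 →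
      (s(q a, q b) ∈ B.image (insEdge n i) ↔ Inserted C a b) :=
    fun a b hab hb => mk_mem_image_insEdge_iff hp hq hins hab hb
  have hprev : ∀ D : Finset (Sym2 (ZMod (n + 1))), (∀ e ∈ D, IsEdge (n + 1) e) →
      B.image (insEdge n i) ⊆ D → s(q 1, q 3) ∈ D → IsBlocker (n + 1) D := by
    intro D hD hsub h3
    refine (hq.isBlocker_iff_not_pierced D).2 ⟨hD, fun h => hCB (.contract_prev hC0 (h.mono ?_))⟩
    rintro a b hab hb - (h | ⟨rfl, rfl⟩)
    exacts [hsub ((hmem a b hab hb).2 h), h3]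
  have hnext : ∀ D : Finset (Sym2 (ZMod (n + 1))), (∀ e ∈ D, IsEdge (n + 1) e) →
      B.image (insEdge n i) ⊆ D →
      (∀ w, 1 < w → w < n → s(p 1, p w) ∈ B → s(q 1, q (w + 1)) ∈ D) → IsBlocker (n + 1) D := by
    intro D hD hsub hw
    refine (hq.isBlocker_iff_not_pierced D).2
      ⟨hD, fun h => hCB (.contract_next (by omega) (h.mono ?_))⟩
    rintro a b hab hb - (h | ⟨rfl, h1, h2⟩)
    · exact hsub ((hmem a b hab hb).2 h)
    · have := hw (b - 1) h1 (by omega) h2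
      rwa [show b - 1 + 1 = b by omega] at this
  constructor
  · rintro ⟨hsat, -⟩
    have hsuff : ∀ e₁ e₂ : Sym2 (ZMod (n + 1)), e₁ ≠ e₂ → q 1 ∈ e₂ →
        IsSaturatedBlocker (n + 1) (B.image (insEdge n i) ∪ {e₁, e₂}) →
        B.image (insEdge n i) ⊆ (B.image (insEdge n i) ∪ {e₁, e₂}).erase e₂ ∧
        e₁ ∈ (B.image (insEdge n i) ∪ {e₁, e₂}).erase e₂ ∧
        (∀ e ∈ (B.image (insEdge n i) ∪ {e₁, e₂}).erase e₂, IsEdge (n + 1) e) ∧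
        ¬ IsBlocker (n + 1) ((B.image (insEdge n i) ∪ {e₁, e₂}).erase e₂) := by
      intro e₁ e₂ hne hv hsat
      refine ⟨fun e he => ?_, ?_, fun e he => ?_, hsat.2 e₂ (by simp)⟩
      · exact Finset.mem_erase.2 ⟨fun h => hnew e he (h ▸ hv), Finset.mem_union_left _ he⟩
      · simp [hne]
      · exact hsat.1.1 e (Finset.mem_of_mem_erase he)
    have hsat' : IsSaturatedBlocker (n + 1) (B.image (insEdge n i) ∪ {e₂, e₁}) := by
      rwa [Finset.pair_comm]
    obtain ⟨z₁, rfl⟩ := hv₁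
    obtain ⟨z₂, rfl⟩ := hv₂
    obtain ⟨x, hx, rfl⟩ := hq.surjective z₁
    obtain ⟨y, hy, rfl⟩ := hq.surjective z₂
    have hx3 : x ≠ 3 := by
      rintro rfl
      obtain ⟨h1, h2, h3, h4⟩ := hsuff _ _ hne (Sym2.mem_mk_left _ _) hsat
      exact h4 (hprev _ h3 h1 h2)
    have hy3 : y ≠ 3 := by
      rintro rfl
      obtain ⟨h1, h2, h3, h4⟩ := hsuff _ _ hne.symm (Sym2.mem_mk_left _ _) hsat'
      exact h4 (hprev _ h3 h1 h2)
    have hstar : ∀ w, 1 < w → w < n → s(p 1, p w) ∈ B → x = w + 1 ∨ y = w + 1 := by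
      intro w hw1 hwn hwB
      by_contra! hxy
      have hpierced : Pierced (n + 1) fun a b => Inserted C a b ∨ (a = 1 ∧ b ≠ 3 ∧ b ≠ w + 1) := by
        by_cases hw : w = 3
        · subst hw
          exact pierced_insert_fan_zero hC hC0
        · have hw' : 3 < w := by
            have := hdiag 1 w hw1 hwn hwB
            unfold SpansDiagonal at this
            omega
          rw [Sym2.eq_swap] at hwB
          refine pierced_insert_fan_leaf hw' hwn (fun a ha h => hleaf w hwn hw hwB a ha h.2) ?_
          rintro b hb ⟨h1, h2⟩
          rw [Sym2.eq_swap] at h2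
          have := hleaf w hwn hw hwB b hb h2
          omega
      refine ((hq.isBlocker_iff_not_pierced _).1 hsat.1).2 (hpierced.mono ?_)
      intro a b hab hb hd hm
      have hd' := hd.1
      rw [Finset.mem_union, Finset.mem_insert, Finset.mem_singleton, hmem a b hab hb,
        hq.mk_eq_iff (by omega) hb (by omega) hx, hq.mk_eq_iff (by omega) hb (by omega) hy] at hm
      rcases hm with h | h | h
      · exact Or.inl h
      · exact Or.inr (by omega)
      · exact Or.inr (by omega)
    have hfin : ∀ y, y < n + 1 → s(q 1, q 4) ≠ s(q 1, q y) →
        IsSaturatedBlocker (n + 1) (B.image (insEdge n i) ∪ {s(q 1, q 4), s(q 1, q y)}) →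
        (∀ w, 1 < w → w < n → s(p 1, p w) ∈ B → 4 = w + 1 ∨ y = w + 1) →
        degB n B (p 1) = 2 ∧ ∃ k, 3 < k ∧ k < n ∧ s(p k, p 1) ∈ B ∧
          ({s(q 1, q 4), s(q 1, q y)} : Finset (Sym2 (ZMod (n + 1)))) =
            {s(q 1, q 4), s(q 1, q (k + 1))} := by
      intro y hy hne hsat hstar
      have hy4 : y ≠ 4 := by
        rintro rfl
        exact hne rfl
      have hk : ∃ k, 1 < k ∧ k < n ∧ s(p 1, p k) ∈ B ∧ y = k + 1 := by
        by_contra! hno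
        obtain ⟨h1, h2, h3, h4⟩ := hsuff _ _ hne (Sym2.mem_mk_left _ _) hsat
        refine h4 (hnext _ h3 h1 fun w hw1 hwn hwB => ?_)
        have := hno w hw1 hwn hwB
        rw [show w + 1 = 4 by have := hstar w hw1 hwn hwB; omega]
        exact h2
      obtain ⟨k, hk1, hkn, hkB, rfl⟩ := hk
      have hd := hdiag 1 k hk1 hkn hkB
      unfold SpansDiagonal at hd
      refine ⟨?_, k, by omega, hkn, by rwa [Sym2.eq_swap], rfl⟩
      have hfilter : B.filter (fun e => p 1 ∈ e) = {s(p 1, p 3), s(p 1, p k)} := by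
        ext e
        rw [Finset.mem_filter, Finset.mem_insert, Finset.mem_singleton]
        constructor
        · rintro ⟨heB, z, rfl⟩
          obtain ⟨w, hw, rfl⟩ := hp.surjective z
          have hw1 : 1 < w := by
            rcases lt_trichotomy w 1 with h | rfl | h
            · obtain rfl : w = 0 := by omega
              rw [Sym2.eq_swap] at heB
              have := hzero 1 (by omega) (by omega) heB
              omega
            · obtain ⟨a, b, hab, hne⟩ := hB.1.1 _ heB
              rcases Sym2.eq_iff.1 hab with ⟨rfl, h⟩ | ⟨rfl, h⟩
              exacts [absurd h hne, absurd h.symm hne]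
            · exact h
          rcases hstar w hw1 hw heB with h | h
          · exact Or.inl (by rw [show w = 3 by omega])
          · exact Or.inr (by rw [show w = k by omega])
        · rintro (rfl | rfl)
          exacts [⟨hthree, Sym2.mem_mk_left _ _⟩, ⟨hkB, Sym2.mem_mk_left _ _⟩]
      rw [degB, hfilter, Finset.card_pair]
      rw [Ne, hp.mk_eq_iff (by omega) (by omega) (by omega) (by omega)]
      omega
    rcases hstar 3 (by omega) (by omega) hthree with rfl | rfl
    · exact hfin y hy hne hsat hstar
    · rw [Finset.pair_comm]
      exact hfin x hx hne.symm hsat' fun w h1 h2 h3 => (hstar w h1 h2 h3).symm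
  · rintro ⟨hdeg, k, hk3, hkn, hkB, heq⟩
    have hkB' : s(p 1, p k) ∈ B := by rwa [Sym2.eq_swap]
    have hfilter : B.filter (fun e => p 1 ∈ e) = {s(p 1, p 3), s(p 1, p k)} := by
      refine (Finset.eq_of_subset_of_card_le ?_ ?_).symm
      · intro e he
        rw [Finset.mem_insert, Finset.mem_singleton] at he
        rw [Finset.mem_filter]
        rcases he with rfl | rfl
        exacts [⟨hthree, Sym2.mem_mk_left _ _⟩, ⟨hkB', Sym2.mem_mk_left _ _⟩]
      · rw [degB] at hdeg
        rw [hdeg, Finset.card_pair]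
        rw [Ne, hp.mk_eq_iff (by omega) (by omega) (by omega) (by omega)]
        omega
    have hstar : ∀ w, w < n → s(p 1, p w) ∈ B → w = 3 ∨ w = k := by
      intro w hw hwB
      have : s(p 1, p w) ∈ B.filter (fun e => p 1 ∈ e) :=
        Finset.mem_filter.2 ⟨hwB, Sym2.mem_mk_left _ _⟩
      rw [hfilter, Finset.mem_insert, Finset.mem_singleton,
        hp.mk_eq_iff (by omega) (by omega) (by omega) (by omega),
        hp.mk_eq_iff (by omega) (by omega) (by omega) (by omega)] at this
      omega
    have hcard' : (B.image (insEdge n i) ∪ {e₁, e₂}).card = n := by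
      rw [Finset.card_union_of_disjoint, Finset.card_image_of_injective _
        (insEdge_injective_s14 hp hq hins), Finset.card_pair hne, hcard]
      · omega
      · rw [Finset.disjoint_left]
        intro e he he'
        rw [Finset.mem_insert, Finset.mem_singleton] at he'
        rcases he' with rfl | rfl
        exacts [hnew _ he hv₁, hnew _ he hv₂]
    refine ⟨⟨?_, ?_⟩, hcard'⟩
    · refine hnext _ ?_ Finset.subset_union_left ?_
      · intro e he
        rw [Finset.mem_union, Finset.mem_insert, Finset.mem_singleton] at he
        rcases he with he | rfl | rfl
        exacts [hedge e he, he₁, he₂]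
      · intro w _ hwn hwB
        rw [heq]
        rcases hstar w hwn hwB with rfl | rfl <;> simp
    · rw [heq]
      intro e he hblk
      have hnp := ((hq.isBlocker_iff_not_pierced _).1 hblk).2
      have hsub : ∀ e₀ ∈ B, Pierced n (labelPairs p (B.erase e₀)) := by
        intro e₀ he₀
        by_contra hnp
        refine hB.2 e₀ he₀ ((hp.isBlocker_iff_not_pierced _).2
          ⟨fun e he => hB.1.1 e (Finset.mem_of_mem_erase he), fun h => hnp (h.mono ?_)⟩)
        exact fun a b _ _ _ h => h.2
      have hnewEdge : ∀ w, w < n → 1 < w → s(p 1, p w) ∈ B → e = s(q 1, q (w + 1)) → False := by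
        rintro w hwn hw1 hwB rfl
        have hsplit : Pierced n fun a b => C a b ∧ ¬ (a = 1 ∧ b = w) := by
          refine (hsub _ hwB).mono fun a b hab hb _ h => ⟨hab, Finset.mem_erase.2 ⟨?_, h.1.2⟩⟩
          rw [Ne, hp.mk_eq_iff (by omega) hb (by omega) hwn]
          have := h.2
          omega
        refine hnp ((hsplit.insert_of_split hC).mono fun a b hab hb hd h => ?_)
        rw [Finset.mem_erase, Finset.mem_union, Finset.mem_insert, Finset.mem_singleton,
          hmem a b hab hb] at h
        rcases h.2 with h₁ | h₁ | h₁
        · exact Or.inl h₁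
        · rw [hq.mk_eq_iff (by omega) hb (by omega) (by omega)] at h₁
          have hd' := hd.1
          obtain ⟨rfl, rfl⟩ : a = 1 ∧ b = 4 := by omega
          exact Or.inr ⟨rfl, ⟨by omega, hthree⟩, fun hb' => h.1 (by rw [hb'])⟩
        · rw [hq.mk_eq_iff (by omega) hb (by omega) (by omega)] at h₁
          have hd' := hd.1
          obtain ⟨rfl, rfl⟩ : a = 1 ∧ b = k + 1 := by omega
          exact Or.inr ⟨rfl, ⟨by omega, hkB'⟩, fun hb' => h.1 (by rw [hb'])⟩
      rw [Finset.mem_union, Finset.mem_insert, Finset.mem_singleton] at he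
      rcases he with he | he | he
      · obtain ⟨e₀, he₀, rfl⟩ := Finset.mem_image.1 he
        refine hnp (((hsub e₀ he₀).insert_of_cut ?_).mono fun a b hab hb hd h => ?_)
        · exact fun a b hab hb h => hdiag a b hab hb (Finset.mem_of_mem_erase h.2)
        · rw [Finset.mem_erase, Finset.mem_union, Finset.mem_insert, Finset.mem_singleton] at h
          have hd' := hd.1
          rcases h.2 with h₁ | h₁ | h₁
          · refine Or.inl ((mk_mem_image_insEdge_iff hp hq hins hab hb).1 ?_)
            obtain ⟨f, hf, hfe⟩ := Finset.mem_image.1 h₁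
            refine Finset.mem_image.2 ⟨f, Finset.mem_erase.2 ⟨?_, hf⟩, hfe⟩
            rintro rfl
            exact h.1 hfe.symm
          · rw [hq.mk_eq_iff (by omega) hb (by omega) (by omega)] at h₁
            exact Or.inr (by omega)
          · rw [hq.mk_eq_iff (by omega) hb (by omega) (by omega)] at h₁
            exact Or.inr (by omega)
      · exact hnewEdge 3 (by omega) (by omega) hthree he
      · exact hnewEdge k hkn (by omega) hkB' he

end Main


theorem StdForm.natCast_mem_iff {n m : ℕ} {idx : ℕ → ℕ} {B : Finset (Sym2 (ZMod n))}
    (h : StdForm n m idx B) (hn : 3 ≤ n) {a b : ℕ} (ha : a < n) (hb : b < n) :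
    s((a : ZMod n), (b : ZMod n)) ∈ B ↔
      (a ≤ m ∧ b = a + 2) ∨ (b ≤ m ∧ a = b + 2) ∨
      (m + 2 < a ∧ b = idx (a - m - 2) ∧ 1 ≤ b ∧ b ≤ m + 1) ∨
      (m + 2 < b ∧ a = idx (b - m - 2) ∧ 1 ≤ a ∧ a ≤ m + 1) := by
  obtain ⟨hm1, hmn, hidx, rfl, -⟩ := h
  have hp := isLabelling_natCast (N := n) (by omega)
  simp only [Finset.mem_union, Finset.mem_image, Finset.mem_range, Finset.mem_Icc] at hidx ⊢
  constructor
  · rintro (⟨j, hj, heq⟩ | ⟨j, hj, heq⟩)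
    · rw [hp.mk_eq_iff (by omega) (by omega) ha hb] at heq
      omega
    · have := hidx j hj
      rw [hp.mk_eq_iff (by omega) (by omega) ha hb] at heq
      rcases heq with ⟨rfl, rfl⟩ | ⟨rfl, rfl⟩ <;>
      · rw [show m + 2 + j - m - 2 = j by omega]
        omega
  · rintro (⟨h1, rfl⟩ | ⟨h1, rfl⟩ | ⟨h1, rfl, -⟩ | ⟨h1, rfl, -⟩)
    · exact Or.inl ⟨a, by omega, rfl⟩
    · exact Or.inl ⟨b, by omega, Sym2.eq_swap⟩
    · exact Or.inr ⟨a - m - 2, by omega, by rw [show m + 2 + (a - m - 2) = a by omega]⟩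
    · exact Or.inr ⟨b - m - 2, by omega, by
        rw [show m + 2 + (b - m - 2) = b by omega, Sym2.eq_swap]⟩

end ConvexBlocker

open ConvexBlocker in
/-- inserting a vertex between the two leftmost (part (a)) or the two rightmost
(part (b)) vertices of the boundary net of a standard-form saturated blocker `B` of size
`n-2`, and adding two edges at the new vertex, yields a saturated blocker of size `n` of the
`(n+1)`-gon iff the stated degree and edge conditions hold. -/
theorem insert_vertex_between_end_vertices_of_boundary_net
    (n : ℕ) (hn : 7 ≤ n) (m : ℕ) (idx : ℕ → ℕ) (B : Finset (Sym2 (ZMod n)))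
    (hB : IsSaturatedBlocker n B) (hcard : B.card = n - 2)
    (hstd : StdForm n m idx B) :
    (∀ e₁ e₂ : Sym2 (ZMod (n + 1)), e₁ ≠ e₂ →
      IsEdge (n + 1) e₁ → IsEdge (n + 1) e₂ →
      ((1 : ZMod (n + 1)) ∈ e₁) → ((1 : ZMod (n + 1)) ∈ e₂) →
      ((IsSaturatedBlocker (n + 1) (B.image (insEdge n 0) ∪ {e₁, e₂}) ∧
          (B.image (insEdge n 0) ∪ {e₁, e₂}).card = n) ↔
        (degB n B 1 = 2 ∧ ∃ k : ℕ, m + 2 < k ∧ k ≤ n - 1 ∧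
          s((k : ZMod n), (1 : ZMod n)) ∈ B ∧
          ({e₁, e₂} : Finset (Sym2 (ZMod (n + 1)))) =
            {s((1 : ZMod (n + 1)), insVx n 0 ((3 : ℕ) : ZMod n)),
             s((1 : ZMod (n + 1)), insVx n 0 (k : ZMod n))}))) ∧
    (∀ e₁ e₂ : Sym2 (ZMod (n + 1)), e₁ ≠ e₂ →
      IsEdge (n + 1) e₁ → IsEdge (n + 1) e₂ →
      (((m + 2 : ℕ) : ZMod (n + 1)) ∈ e₁) → (((m + 2 : ℕ) : ZMod (n + 1)) ∈ e₂) →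
      ((IsSaturatedBlocker (n + 1) (B.image (insEdge n (m + 1)) ∪ {e₁, e₂}) ∧
          (B.image (insEdge n (m + 1)) ∪ {e₁, e₂}).card = n) ↔
        (degB n B ((m + 1 : ℕ) : ZMod n) = 2 ∧ ∃ k : ℕ, m + 2 < k ∧ k ≤ n - 1 ∧
          s((k : ZMod n), ((m + 1 : ℕ) : ZMod n)) ∈ B ∧
          ({e₁, e₂} : Finset (Sym2 (ZMod (n + 1)))) =
            {s(((m + 2 : ℕ) : ZMod (n + 1)), insVx n (m + 1) ((m - 1 : ℕ) : ZMod n)),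
             s(((m + 2 : ℕ) : ZMod (n + 1)), insVx n (m + 1) (k : ZMod n))}))) := by
  have hm1 := hstd.1
  have hmn := hstd.2.1
  have hmem := fun {a b : ℕ} => hstd.natCast_mem_iff (by omega) (a := a) (b := b)
  have : NeZero n := ⟨by omega⟩
  constructor
  · intro e₁ e₂ hne he₁ he₂ hv₁ hv₂
    have hins : ∀ x : ℕ, x < n →
        insVx n 0 (x : ZMod n) = ((if x = 0 then 0 else x + 1 : ℕ) : ZMod (n + 1)) := by
      intro x hx
      rw [insVx, ZMod.val_cast_of_lt hx]
      by_cases h : x = 0 <;> simp [h]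
    have key := isSaturatedBlocker_insert_iff_s14 hn (isLabelling_natCast (by omega))
      (isLabelling_natCast (by omega)) hins hB hcard
      (fun a b hab hb h => by
        rw [hmem (by omega) hb] at h
        unfold SpansDiagonal
        omega)
      (fun b h0 hb h => by
        rw [hmem (by omega) hb] at h
        omega)
      ((hmem (by omega) (by omega)).2 (by omega))
      (fun k hk hk3 h a ha h₁ => by
        rw [hmem hk (by omega)] at h
        rw [hmem ha hk] at h₁
        omega)
      hne he₁ he₂ (by simpa using hv₁) (by simpa using hv₂)
    rw [key]
    simp only [Nat.cast_one]
    refine and_congr_right fun _ => exists_congr fun k => ?_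
    constructor
    · rintro ⟨h1, h2, h3, h4⟩
      have h3' := h3
      rw [← Nat.cast_one, hmem h2 (by omega)] at h3'
      refine ⟨by omega, by omega, h3, ?_⟩
      rw [h4, hins 3 (by omega), hins k h2, if_neg (by omega), if_neg (by omega)]
    · rintro ⟨h1, h2, h3, h4⟩
      refine ⟨by omega, by omega, h3, ?_⟩
      rw [h4, hins 3 (by omega), hins k (by omega), if_neg (by omega), if_neg (by omega)]
  · intro e₁ e₂ hne he₁ he₂ hv₁ hv₂
    have hpos : ∀ x : ℕ, x < n → ∃ y < n, ((m + 2 : ℕ) : ZMod n) - (x : ZMod n) = (y : ZMod n) ∧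
        (x ≤ m + 2 ∧ y = m + 2 - x ∨ m + 2 < x ∧ y = n + m + 2 - x) := by
      intro x hx
      by_cases h : x ≤ m + 2
      · exact ⟨m + 2 - x, by omega, by rw [Nat.cast_sub h], by omega⟩
      · refine ⟨n + m + 2 - x, by omega, ?_, by omega⟩
        rw [Nat.cast_sub (by omega), add_assoc, Nat.cast_add n, ZMod.natCast_self, zero_add]
    have hins : ∀ x : ℕ, x < n → insVx n (m + 1) (((m + 2 : ℕ) : ZMod n) - (x : ZMod n)) =
        ((m + 3 : ℕ) : ZMod (n + 1)) - ((if x = 0 then 0 else x + 1 : ℕ) : ZMod (n + 1)) := by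
      intro x hx
      obtain ⟨y, hy, hxy, hcases⟩ := hpos x hx
      rw [hxy, insVx, ZMod.val_cast_of_lt hy, eq_sub_iff_add_eq]
      by_cases h0 : x = 0
      · rw [if_neg (by omega), if_pos h0, ← Nat.cast_add]
        congr 1
        omega
      · rw [if_neg h0]
        rcases hcases with h | h
        · rw [if_pos (by omega), ← Nat.cast_add]
          congr 1
          omega
        · rw [if_neg (by omega), ← Nat.cast_add,
            show y + 1 + (x + 1) = (n + 1) + (m + 3) by omega, Nat.cast_add (n + 1),
            ZMod.natCast_self, zero_add]
    have hq1 : ((m + 3 : ℕ) : ZMod (n + 1)) - ((1 : ℕ) : ZMod (n + 1)) =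
        ((m + 2 : ℕ) : ZMod (n + 1)) := by
      rw [← Nat.cast_sub (by omega)]
      rfl
    have hp1 : ((m + 2 : ℕ) : ZMod n) - ((1 : ℕ) : ZMod n) = ((m + 1 : ℕ) : ZMod n) := by
      rw [← Nat.cast_sub (by omega)]
      rfl
    have hp3 : ((m - 1 : ℕ) : ZMod n) = ((m + 2 : ℕ) : ZMod n) - ((3 : ℕ) : ZMod n) := by
      rw [← Nat.cast_sub (by omega)]
      rfl
    have key := isSaturatedBlocker_insert_iff_s14 hn (isLabelling_sub_natCast (by omega) _)
      (isLabelling_sub_natCast (by omega) _) hins hB hcard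
      (fun a b hab hb h => by
        obtain ⟨a₁, ha', haa, hca⟩ := hpos a (by omega)
        obtain ⟨b₁, hb', hbb, hcb⟩ := hpos b hb
        rw [haa, hbb, hmem ha' hb'] at h
        unfold SpansDiagonal
        omega)
      (fun b h0 hb h => by
        obtain ⟨a₁, ha', haa, hca⟩ := hpos 0 (by omega)
        obtain ⟨b₁, hb', hbb, hcb⟩ := hpos b hb
        rw [haa, hbb, hmem ha' hb'] at h
        omega)
      (by
        rw [hp1, ← hp3, hmem (by omega) (by omega)]
        omega)
      (fun k hk hk3 h a ha h₁ => by
        obtain ⟨a₁, ha', haa, hca⟩ := hpos a ha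
        obtain ⟨k₁, hk', hkk, hck⟩ := hpos k hk
        rw [hp1, hkk, hmem hk' (by omega)] at h
        rw [haa, hkk, hmem ha' hk'] at h₁
        omega)
      hne he₁ he₂ (by rwa [hq1]) (by rwa [hq1])
    rw [key, hp1, hq1]
    refine and_congr_right fun _ => ?_
    constructor
    · rintro ⟨k, h1, h2, h3, h4⟩
      obtain ⟨k₁, hk', hkk, hck⟩ := hpos k h2
      have h3' := h3
      rw [hkk, hmem hk' (by omega)] at h3'
      refine ⟨k₁, by omega, by omega, hkk ▸ h3, ?_⟩
      rw [h4, hp3, hins 3 (by omega), ← hkk, hins k h2, if_neg (by omega), if_neg (by omega)]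
    · rintro ⟨k₁, h1, h2, h3, h4⟩
      obtain ⟨k, hk, hkk, hck⟩ := hpos (n + m + 2 - k₁) (by omega)
      obtain rfl : k = k₁ := by omega
      refine ⟨n + m + 2 - k, by omega, by omega, by rwa [hkk], ?_⟩
      rw [h4, hp3, hins 3 (by omega), ← hkk, hins _ (by omega), if_neg (by omega),
        if_neg (by omega)]
end
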